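/- arXiv:math/0312083 — 4 statements merged into one kernel-verified Lean document; each statement's English description precedes it below -/
import Mathlib

section
/- Multi-homogeneous Bézout theorem: let the complex variables be partitioned into m groups X₁,…,X_m, where the j-th group has k_j+1 variables, and let n = k₁+⋯+k_m. Let f = (f₁,…,f_n) be polynomials in these n+m variables such that each f_i is multi-homogeneous with multidegree (d_{i1},…,d_{im}), i.e. f_i(X₁,…,λX_j,…,X_m) = λ^{d_{ij}} f_i(X₁,…,X_m) for every λ ∈ ℂ and every j. Let B be the coefficient of ζ₁^{k₁}⋯ζ_m^{k_m} in the polynomial ∏_{i=1}^n (Σ_{j=1}^m d_{ij} ζ_j). Then the number of isolated zeros of f in the product of projective spaces ℙ^{k₁}(ℂ) × ⋯ × ℙ^{k_m}(ℂ) is at most B; moreover, if every zero of f in ℙ^{k₁}(ℂ) × ⋯ × ℙ^{k_m}(ℂ) is nonsingular, then f has exactly B zeros. -/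
open MvPolynomial

/-- The quotient topology on a projectivization (the quotient of the nonzero
vectors of a topological vector space by the rescaling action). -/
noncomputable instance projectivizationTopology
    (K V : Type*) [DivisionRing K] [AddCommGroup V] [Module K V] [TopologicalSpace V] :
    TopologicalSpace (Projectivization K V) :=
  inferInstanceAs (TopologicalSpace (Quotient (projectivizationSetoid K V)))

namespace MB

variable {m N : ℕ} {k : Fin m → ℕ}

/-- index type of the variables -/
abbrev Sg {m : ℕ} (k : Fin m → ℕ) := Σ j : Fin m, Fin (k j + 1)

/-- scaling each group -/
def scl (lam : Fin m → ℂ) (x : Sg k → ℂ) : Sg k → ℂ := fun q => lam q.1 * x q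

/-- multihomogeneous -/
def MH (d : Fin m → ℕ) (f : MvPolynomial (Sg k) ℂ) : Prop :=
  ∀ lam x, eval (scl lam x) f = (∏ j, lam j ^ d j) * eval x f

/-- each group of coordinates is nonzero -/
def NZ (x : Sg k → ℂ) : Prop := ∀ j, ∃ r, x ⟨j, r⟩ ≠ 0

/-- evaluation of a system -/
noncomputable def ev (f : Fin N → MvPolynomial (Sg k) ℂ) (x : Sg k → ℂ) : Fin N → ℂ :=
  fun i => eval x (f i)

lemma MH_of_single (f : MvPolynomial (Sg k) ℂ) (d : Fin m → ℕ)
    (h : ∀ (j : Fin m) (lam : ℂ) (p : Sg k → ℂ),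
      eval (fun q => if q.1 = j then lam * p q else p q) f = lam ^ (d j) * eval p f) :
    MH d f := by
  intro lam x
  have key : ∀ s : Finset (Fin m), eval (fun q : Sg k => (if q.1 ∈ s then lam q.1 else 1) * x q) f
      = (∏ j ∈ s, lam j ^ d j) * eval x f := by
    intro s
    induction s using Finset.induction_on with
    | empty => simp
    | insert a s ha ih =>
      rw [Finset.prod_insert ha, mul_assoc, ← ih, ← h a (lam a)]
      congr 1
      congr 1
      funext q
      by_cases hq : q.1 = a
      · simp [hq, ha]
      · simp [hq]
  have := key Finset.univ
  simp only [Finset.mem_univ, if_true] at this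
  exact this

lemma MH.add {d : Fin m → ℕ} {f g : MvPolynomial (Sg k) ℂ} (hf : MH d f) (hg : MH d g) :
    MH d (f + g) := by
  intro lam x
  rw [map_add, map_add, hf, hg]; ring

lemma MH.smul {d : Fin m → ℕ} {f : MvPolynomial (Sg k) ℂ} (c : ℂ) (hf : MH d f) :
    MH d (c • f) := by
  intro lam x
  rw [smul_eval, smul_eval, hf]; ring

lemma MH.mul {d e : Fin m → ℕ} {f g : MvPolynomial (Sg k) ℂ} (hf : MH d f) (hg : MH e g) :
    MH (d + e) (f * g) := by
  intro lam x
  rw [map_mul, map_mul, hf, hg]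
  simp only [Pi.add_apply, pow_add, Finset.prod_mul_distrib]; ring

lemma MH_one : MH (0 : Fin m → ℕ) (1 : MvPolynomial (Sg k) ℂ) := by
  intro lam x; simp

lemma MH_X (q : Sg k) : MH (Pi.single q.1 1) (X q : MvPolynomial (Sg k) ℂ) := by
  intro lam x
  simp only [eval_X, scl]
  congr 1
  rw [Finset.prod_eq_single q.1]
  · simp
  · intro b _ hb; simp [hb]
  · simp

lemma MH.prod {ι : Type*} (s : Finset ι) (d : ι → Fin m → ℕ) (f : ι → MvPolynomial (Sg k) ℂ)
    (h : ∀ i ∈ s, MH (d i) (f i)) : MH (∑ i ∈ s, d i) (∏ i ∈ s, f i) := by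
  classical
  induction s using Finset.induction_on with
  | empty => simpa using MH_one
  | insert a s ha ih =>
    rw [Finset.prod_insert ha, Finset.sum_insert ha]
    exact (h a (by simp)).mul (ih fun i hi => h i (by simp [hi]))

lemma MH.pow {d : Fin m → ℕ} {f : MvPolynomial (Sg k) ℂ} (hf : MH d f) (n : ℕ) :
    MH (n • d) (f ^ n) := by
  have := MH.prod (Finset.range n) (fun _ => d) (fun _ => f) (fun _ _ => hf)
  simpa using this

/-- differential of a polynomial -/
noncomputable def dE (p : MvPolynomial (Sg k) ℂ) (x : Sg k → ℂ) : (Sg k → ℂ) →L[ℂ] ℂ :=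
  ∑ q, eval x (pderiv q p) • ContinuousLinearMap.proj (R := ℂ) (φ := fun _ : Sg k => ℂ) q

lemma dE_apply (p : MvPolynomial (Sg k) ℂ) (x v : Sg k → ℂ) :
    dE p x v = ∑ q, eval x (pderiv q p) * v q := by
  simp [dE]

lemma contDiff_eval (p : MvPolynomial (Sg k) ℂ) : ContDiff ℂ 1 (fun x => eval x p) := by
  induction p using MvPolynomial.induction_on with
  | C a => simpa using contDiff_const
  | add p q hp hq => simpa using hp.add hq
  | mul_X p q hp => simpa using hp.mul (contDiff_apply ℂ ℂ q)

lemma dE_mul (p q : MvPolynomial (Sg k) ℂ) (x : Sg k → ℂ) :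
    dE (p * q) x = eval x p • dE q x + eval x q • dE p x := by
  ext v
  simp only [dE_apply, add_apply, smul_apply, smul_eq_mul,
    Finset.mul_sum, ← Finset.sum_add_distrib, Derivation.leibniz, map_add, map_mul, smul_eq_mul]
  refine Finset.sum_congr rfl fun i _ => by ring

lemma dE_add (p q : MvPolynomial (Sg k) ℂ) (x : Sg k → ℂ) :
    dE (p + q) x = dE p x + dE q x := by
  ext v
  simp only [dE_apply, add_apply, ← Finset.sum_add_distrib, map_add]
  refine Finset.sum_congr rfl fun i _ => by ring

lemma dE_smul (c : ℂ) (q : MvPolynomial (Sg k) ℂ) (x : Sg k → ℂ) :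
    dE (c • q) x = c • dE q x := by
  ext v
  simp only [dE_apply, smul_apply, Derivation.map_smul,
    smul_eval, smul_eq_mul, Finset.mul_sum]
  refine Finset.sum_congr rfl fun i _ => by ring

lemma dE_X (q : Sg k) (x : Sg k → ℂ) : dE (X q) x = ContinuousLinearMap.proj (R := ℂ) (φ := fun _ : Sg k => ℂ) q := by
  ext v
  simp only [dE_apply, pderiv_X]
  rw [Finset.sum_eq_single q]
  · simp
  · intro b _ hb; simp [Pi.single_apply, hb.symm]
  · simp

lemma dE_C (a : ℂ) (x : Sg k → ℂ) : dE (C a) x = 0 := by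
  ext v; simp [dE_apply]

lemma hasFDerivAt_eval (p : MvPolynomial (Sg k) ℂ) (x : Sg k → ℂ) :
    HasFDerivAt (fun x => eval x p) (dE p x) x := by
  induction p using MvPolynomial.induction_on with
  | C a => simpa [dE_C] using hasFDerivAt_const a x
  | add p q hp hq =>
    rw [dE_add]
    simp only [map_add]
    exact hp.add hq
  | mul_X p q hp =>
    have := hp.mul (hasFDerivAt_apply q x)
    rw [dE_mul, dE_X]
    simp only [map_mul, eval_X]
    exact this

/-- Jacobian -/
noncomputable def jac (f : Fin N → MvPolynomial (Sg k) ℂ) (x : Sg k → ℂ) :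
    (Sg k → ℂ) →L[ℂ] (Fin N → ℂ) := ContinuousLinearMap.pi fun i => dE (f i) x

lemma jac_apply (f : Fin N → MvPolynomial (Sg k) ℂ) (x v : Sg k → ℂ) (i : Fin N) :
    jac f x v i = dE (f i) x v := rfl

lemma hasFDerivAt_ev (f : Fin N → MvPolynomial (Sg k) ℂ) (x : Sg k → ℂ) :
    HasFDerivAt (ev f) (jac f x) x :=
  hasFDerivAt_pi.2 fun i => hasFDerivAt_eval (f i) x

/-- all zeros nonsingular -/
def Good (f : Fin N → MvPolynomial (Sg k) ℂ) : Prop :=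
  ∀ x, NZ x → ev f x = 0 → Function.Surjective (jac f x)

lemma NZ.scl {x : Sg k → ℂ} (hx : NZ x) {lam : Fin m → ℂ} (h : ∀ j, lam j ≠ 0) :
    NZ (scl lam x) := by
  intro j
  obtain ⟨r, hr⟩ := hx j
  exact ⟨r, mul_ne_zero (h j) hr⟩

lemma ev_scl {f : Fin N → MvPolynomial (Sg k) ℂ} {d : Fin N → Fin m → ℕ}
    (hf : ∀ i, MH (d i) (f i)) (lam : Fin m → ℂ) (x : Sg k → ℂ) (h : ev f x = 0) :
    ev f (scl lam x) = 0 := by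
  funext i
  have : eval x (f i) = 0 := congrFun h i
  simp [ev, hf i lam x, this]

/-- scaling as a linear map -/
noncomputable def sclL (lam : Fin m → ℂ) : (Sg k → ℂ) →L[ℂ] (Sg k → ℂ) :=
  ContinuousLinearMap.pi fun q => lam q.1 • ContinuousLinearMap.proj (R := ℂ) (φ := fun _ : Sg k => ℂ) q

lemma sclL_apply (lam : Fin m → ℂ) (x : Sg k → ℂ) : sclL lam x = scl lam x := by
  funext q; simp [sclL, scl]

lemma dE_scl {f : MvPolynomial (Sg k) ℂ} {d : Fin m → ℕ}
    (hf : MH d f) (lam : Fin m → ℂ) (x v : Sg k → ℂ) :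
    dE f (scl lam x) (scl lam v) = (∏ j, lam j ^ d j) * dE f x v := by
  have h1 : HasFDerivAt (fun x => eval (sclL lam x) f) ((dE f (sclL lam x)).comp (sclL lam)) x :=
    (hasFDerivAt_eval f (sclL lam x)).comp x (sclL lam).hasFDerivAt
  have h2 : HasFDerivAt (fun x => eval (sclL lam x) f) ((∏ j, lam j ^ d j) • dE f x) x := by
    have := (hasFDerivAt_eval f x).const_mul (∏ j, lam j ^ d j)
    have e : (fun x => eval (sclL lam x) f) = fun y => (∏ j, lam j ^ d j) * eval y f := by
      funext y; rw [sclL_apply, hf]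
    rw [e]; exact this
  have := congrArg (fun L => L v) (h1.unique h2)
  simpa [sclL_apply] using this

lemma surj_scl {f : Fin N → MvPolynomial (Sg k) ℂ} {d : Fin N → Fin m → ℕ}
    (hf : ∀ i, MH (d i) (f i)) (lam : Fin m → ℂ) (hl : ∀ j, lam j ≠ 0) (x : Sg k → ℂ)
    (h : Function.Surjective (jac f x)) :
    Function.Surjective (jac f (scl lam x)) := by
  intro y
  obtain ⟨v, hv⟩ := h (fun i => (∏ j, lam j ^ d i j)⁻¹ * y i)
  refine ⟨scl lam v, ?_⟩
  funext i
  have hi := congrFun hv i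
  rw [jac_apply] at hi ⊢
  rw [dE_scl (hf i), hi, ← mul_assoc, mul_inv_cancel₀, one_mul]
  exact Finset.prod_ne_zero_iff.2 fun j _ => pow_ne_zero _ (hl j)

/-- Euler vector -/
def eul (j : Fin m) (x : Sg k → ℂ) : Sg k → ℂ := fun q => if q.1 = j then x q else 0

lemma jac_eul {f : Fin N → MvPolynomial (Sg k) ℂ} {d : Fin N → Fin m → ℕ}
    (hf : ∀ i, MH (d i) (f i)) (x : Sg k → ℂ) (h : ev f x = 0) (j : Fin m) :
    jac f x (eul j x) = 0 := by
  funext i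
  rw [jac_apply]
  have h0 : HasDerivAt (fun s : ℂ => x + s • eul j x) (eul j x) 0 := by
    have := ((hasDerivAt_id (0 : ℂ)).smul_const (eul j x)).const_add x
    simpa using this
  have h1 : HasDerivAt (fun s : ℂ => eval (x + s • eul j x) (f i)) (dE (f i) x (eul j x)) 0 := by
    have h2 : HasFDerivAt (fun x => eval x (f i)) (dE (f i) x) (x + (0:ℂ) • eul j x) := by
      simpa using hasFDerivAt_eval (f i) x
    exact h2.comp_hasDerivAt 0 h0
  have h3 : (fun s : ℂ => eval (x + s • eul j x) (f i)) = fun _ => 0 := by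
    funext s
    have : x + s • eul j x = scl (fun j' => if j' = j then 1 + s else 1) x := by
      funext q
      simp only [scl, eul, Pi.add_apply, Pi.smul_apply, smul_eq_mul]
      split_ifs <;> ring
    rw [this]
    exact congrFun (ev_scl hf _ x h) i
  rw [h3] at h1
  exact h1.unique (hasDerivAt_const _ _)

end MB

namespace MB
variable {m N : ℕ} {k : Fin m → ℕ}

/-- multidegree of an exponent -/
noncomputable def mdeg (s : Sg k →₀ ℕ) : Fin m →₀ ℕ :=
  Finsupp.equivFunOnFinite.symm fun j => ∑ r, s ⟨j, r⟩

lemma mdeg_apply (s : Sg k →₀ ℕ) (j : Fin m) : mdeg s j = ∑ r, s ⟨j, r⟩ := rfl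

lemma extract (Q : MvPolynomial (Sg k) ℂ) (x : Sg k → ℂ)
    (h : ∀ lam : Fin m → ℂ, (∀ j, lam j ≠ 0) → eval (scl lam x) Q = 0) (D : Fin m →₀ ℕ) :
    ∑ s ∈ Q.support with mdeg s = D, coeff s Q * ∏ q, x q ^ s q = 0 := by
  classical
  set R : MvPolynomial (Fin m) ℂ :=
    ∑ s ∈ Q.support, monomial (mdeg s) (coeff s Q * ∏ q, x q ^ s q) with hR
  have hR0 : R = 0 := by
    refine MvPolynomial.funext_set (fun _ => {0}ᶜ) (fun _ => (Set.finite_singleton _).infinite_compl) ?_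
    intro lam hlam
    have := h lam (fun j => by simpa using hlam j (Set.mem_univ j))
    rw [eval_eq'] at this
    rw [map_zero, ← this, hR, map_sum]
    refine Finset.sum_congr rfl fun s _ => ?_
    rw [eval_monomial, mul_assoc]
    congr 1
    simp only [scl, mul_pow, Finset.prod_mul_distrib]
    rw [mul_comm]
    congr 1
    rw [Finsupp.prod_fintype _ _ (fun _ => pow_zero _), Fintype.prod_sigma]
    refine Finset.prod_congr rfl fun j _ => ?_
    rw [mdeg_apply]
    exact (Finset.prod_pow_eq_pow_sum _ _ _).symm
  have := congrArg (coeff D) hR0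
  rw [hR, coeff_sum, coeff_zero] at this
  simp only [coeff_monomial] at this
  rw [Finset.sum_filter]
  exact this

lemma finite_mdeg (D : Fin m →₀ ℕ) : {s : Sg k →₀ ℕ | mdeg s = D}.Finite := by
  refine (Set.finite_Iic (Finsupp.equivFunOnFinite.symm fun q : Sg k => D q.1)).subset ?_
  intro s hs q
  have : mdeg s q.1 = D q.1 := by rw [hs]
  rw [mdeg_apply] at this
  show s q ≤ D q.1
  rw [← this]
  exact Finset.single_le_sum (f := fun r => s ⟨q.1, r⟩) (fun _ _ => Nat.zero_le _) (Finset.mem_univ q.2)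

theorem elim {ι : Type*} (G : ι → MvPolynomial (Sg k) (Polynomial ℂ))
    (hinv : ∀ (t : ℂ) (lam : Fin m → ℂ) (x : Sg k → ℂ), NZ x → (∀ j, lam j ≠ 0) →
      (∀ i, eval x (map (Polynomial.evalRingHom t) (G i)) = 0) →
      ∀ i, eval (scl lam x) (map (Polynomial.evalRingHom t) (G i)) = 0)
    (t0 : ℂ) (h0 : ∀ x, NZ x → ∃ i, eval x (map (Polynomial.evalRingHom t0) (G i)) ≠ 0) :
    {t | ∃ x, NZ x ∧ ∀ i, eval x (map (Polynomial.evalRingHom t) (G i)) = 0}.Finite := by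
  classical
  set I := Ideal.span (Set.range G) with hI
  set φ := fun t : ℂ => (map (Polynomial.evalRingHom t) :
    MvPolynomial (Sg k) (Polynomial ℂ) →+* MvPolynomial (Sg k) ℂ) with hφ
  set I0 := I.map (φ t0) with hI0
  have hrad : ∀ r : (∀ j, Fin (k j + 1)), ∃ n, (∏ j, X ⟨j, r j⟩ : MvPolynomial (Sg k) ℂ) ^ n ∈ I0 := by
    intro r
    have : (∏ j, X ⟨j, r j⟩ : MvPolynomial (Sg k) ℂ) ∈ vanishingIdeal ℂ (zeroLocus ℂ I0) := by
      rw [mem_vanishingIdeal_iff]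
      intro x hx
      by_contra hne
      have hnz : NZ x := by
        intro j
        refine ⟨r j, ?_⟩
        rw [map_prod, ← ne_eq, Finset.prod_ne_zero_iff] at hne
        simpa using hne j (Finset.mem_univ j)
      obtain ⟨i, hi⟩ := h0 x hnz
      apply hi
      rw [mem_zeroLocus_iff] at hx
      have := hx (φ t0 (G i)) (Ideal.mem_map_of_mem _ (Ideal.subset_span ⟨i, rfl⟩))
      rw [aeval_eq_eval] at this
      exact this
    rw [vanishingIdeal_zeroLocus_eq_radical] at this
    exact this
  choose n hn using hrad
  set D0 := ∑ r, n r with hD0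
  have hn' : ∀ r : (∀ j, Fin (k j + 1)), (∏ j, X ⟨j, r j⟩ : MvPolynomial (Sg k) ℂ) ^ D0 ∈ I0 := by
    intro r
    exact I0.mem_of_dvd (pow_dvd_pow _ (Finset.single_le_sum (f := n) (fun _ _ => Nat.zero_le _) (Finset.mem_univ r))) (hn r)
  set D : Fin m →₀ ℕ := Finsupp.equivFunOnFinite.symm fun j => (k j + 1) * D0 with hD
  have hDj : ∀ j, D j = (k j + 1) * D0 := fun j => rfl
  have hmem : ∀ μ : Sg k →₀ ℕ, mdeg μ = D → (monomial μ 1 : MvPolynomial (Sg k) ℂ) ∈ I0 := by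
    intro μ hμ
    have : ∀ j, ∃ r, D0 ≤ μ ⟨j, r⟩ := by
      intro j
      have h1 : mdeg μ j = (k j + 1) * D0 := by rw [hμ, hDj]
      rw [mdeg_apply] at h1
      by_contra! hcon
      have := Finset.sum_lt_sum_of_nonempty (s := (Finset.univ : Finset (Fin (k j + 1)))) Finset.univ_nonempty
        (fun r _ => hcon r)
      rw [h1] at this
      simp at this
    choose r hr using this
    refine Ideal.mem_of_dvd _ ?_ (hn' r)
    have e : (∏ j, X ⟨j, r j⟩ : MvPolynomial (Sg k) ℂ) ^ D0
        = monomial (∑ j, Finsupp.single (⟨j, r j⟩ : Sg k) D0) 1 := by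
      rw [← Finset.prod_pow, monomial_sum_one]
      refine Finset.prod_congr rfl fun j _ => ?_
      rw [X_pow_eq_monomial]
    rw [e]
    have hle : (∑ j, Finsupp.single (⟨j, r j⟩ : Sg k) D0) ≤ μ := by
      rintro ⟨j, s⟩
      rw [Finsupp.finsetSum_apply, Finset.sum_eq_single j]
      · by_cases hs : r j = s
        · subst hs; simpa using hr j
        · rw [Finsupp.single_eq_of_ne]
          · exact Nat.zero_le _
          · intro h; apply hs; simpa using h.symm
      · intro b _ hb
        rw [Finsupp.single_eq_of_ne]
        intro h
        exact hb (congrArg Sigma.fst h).symm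
      · simp
    refine ⟨monomial (μ - ∑ j, Finsupp.single (⟨j, r j⟩ : Sg k) D0) 1, ?_⟩
    rw [monomial_mul, add_tsub_cancel_of_le hle, one_mul]
  have hsurj : Function.Surjective (φ t0) := by
    apply MvPolynomial.map_surjective
    intro c
    exact ⟨Polynomial.C c, by simp⟩
  have hlift : ∀ μ : {s : Sg k →₀ ℕ // mdeg s = D}, ∃ Q ∈ I, φ t0 Q = monomial μ.1 1 := by
    intro μ
    exact (Ideal.mem_map_iff_of_surjective _ hsurj).1 (hmem μ.1 μ.2)
  choose Q hQI hQ using hlift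
  have : Fintype {s : Sg k →₀ ℕ // mdeg s = D} := (finite_mdeg D).fintype
  set A : Matrix {s : Sg k →₀ ℕ // mdeg s = D} {s : Sg k →₀ ℕ // mdeg s = D} (Polynomial ℂ) :=
    fun μ ν => coeff ν.1 (Q μ) with hA
  have hAt : ∀ t, A.det.eval t = Matrix.det (Matrix.of fun μ ν => coeff ν.1 (φ t (Q μ)) :
      Matrix {s : Sg k →₀ ℕ // mdeg s = D} {s : Sg k →₀ ℕ // mdeg s = D} ℂ) := by
    intro t
    rw [← Polynomial.coe_evalRingHom, RingHom.map_det]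
    congr 1
  have hdet : A.det ≠ 0 := by
    intro h
    have h1 := hAt t0
    rw [h] at h1
    have : (Matrix.of fun μ ν => coeff ν.1 (φ t0 (Q μ)) :
      Matrix {s : Sg k →₀ ℕ // mdeg s = D} {s : Sg k →₀ ℕ // mdeg s = D} ℂ) = 1 := by
      ext μ ν
      rw [Matrix.of_apply, hQ, coeff_monomial, Matrix.one_apply]
      simp [Subtype.ext_iff]
    rw [this] at h1
    simp at h1
  refine (Polynomial.finite_setOfPred_isRoot hdet).subset ?_
  rintro t ⟨x, hx, hz⟩
  by_contra hroot
  have hroot' : A.det.eval t ≠ 0 := hroot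
  rw [hAt] at hroot'
  have hvan : ∀ μ, ∀ lam : Fin m → ℂ, (∀ j, lam j ≠ 0) → eval (scl lam x) (φ t (Q μ)) = 0 := by
    intro μ lam hlam
    have hsub : I ≤ RingHom.ker ((eval (scl lam x)).comp (φ t)) := by
      rw [hI, Ideal.span_le]
      rintro _ ⟨i, rfl⟩
      exact hinv t lam x hx hlam hz i
    exact hsub (hQI μ)
  have hvec : Matrix.mulVec (Matrix.of fun μ ν => coeff ν.1 (φ t (Q μ)) :
      Matrix {s : Sg k →₀ ℕ // mdeg s = D} {s : Sg k →₀ ℕ // mdeg s = D} ℂ)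
      (fun ν => ∏ q, x q ^ ν.1 q) = 0 := by
    funext μ
    have h1 := extract (φ t (Q μ)) x (hvan μ) D
    rw [Pi.zero_apply, ← h1]
    simp only [Matrix.mulVec, dotProduct, Matrix.of_apply]
    rw [← Finset.sum_subtype_of_mem (p := fun s => mdeg s = D)
      (f := fun s => coeff s (φ t (Q μ)) * ∏ q, x q ^ s q) (by simp)]
    symm
    apply Finset.sum_subset (Finset.subset_univ _)
    intro ν _ hν
    have : coeff ν.1 (φ t (Q μ)) = 0 := by
      by_contra hc
      apply hν
      simp [hc, ν.2]
    rw [this, zero_mul]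
  have hzero := Matrix.eq_zero_of_mulVec_eq_zero hroot' hvec
  choose r hr using hx
  set ν : Sg k →₀ ℕ := Finsupp.equivFunOnFinite.symm fun q => if q.2 = r q.1 then D q.1 else 0 with hν
  have hνD : mdeg ν = D := by
    ext j
    rw [mdeg_apply]
    simp [hν]
  have := congrFun hzero ⟨ν, hνD⟩
  rw [Pi.zero_apply, Finset.prod_eq_zero_iff] at this
  obtain ⟨⟨j, s⟩, _, hq⟩ := this
  have h2 : ν ⟨j, s⟩ = if s = r j then D j else 0 := rfl
  simp only [h2] at hq
  split_ifs at hq with hs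
  · subst hs
    exact hr j (eq_zero_of_pow_eq_zero hq)
  · simp at hq

end MB

namespace MB
variable {m N : ℕ} {k : Fin m → ℕ}

/-- Jacobian times a constant matrix -/
noncomputable def JR (f : Fin N → MvPolynomial (Sg k) ℂ) (x : Sg k → ℂ)
    (R : Matrix (Sg k) (Fin N) ℂ) : Matrix (Fin N) (Fin N) ℂ :=
  Matrix.of fun i i' => dE (f i) x (fun q => R q i')

lemma surj_iff (f : Fin N → MvPolynomial (Sg k) ℂ) (x : Sg k → ℂ) :
    Function.Surjective (jac f x) ↔ ∃ R, (JR f x R).det ≠ 0 := by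
  constructor
  · intro h
    choose v hv using fun i : Fin N => h (Pi.single i 1)
    refine ⟨fun q i => v i q, ?_⟩
    have : JR f x (fun q i => v i q) = 1 := by
      ext i i'
      have := congrFun (hv i') i
      rw [jac_apply] at this
      simp only [JR, Matrix.of_apply]
      rw [this, Matrix.one_apply, Pi.single_apply]
    rw [this]; simp
  · rintro ⟨R, hR⟩ y
    refine ⟨R.mulVec ((JR f x R)⁻¹.mulVec y), ?_⟩
    have h1 : ∀ w, jac f x (R.mulVec w) = (JR f x R).mulVec w := by
      intro w
      funext i
      rw [jac_apply, dE_apply]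
      simp only [Matrix.mulVec, dotProduct, JR, Matrix.of_apply, dE_apply, Finset.mul_sum,
        Finset.sum_mul]
      rw [Finset.sum_comm]
      refine Finset.sum_congr rfl fun _ _ => Finset.sum_congr rfl fun _ _ => by ring
    rw [h1, Matrix.mulVec_mulVec, Matrix.mul_nonsing_inv _ (isUnit_iff_ne_zero.2 hR), Matrix.one_mulVec]

set_option maxHeartbeats 400000 in
theorem good_line (a b : Fin N → MvPolynomial (Sg k) ℂ) (d : Fin N → Fin m → ℕ)
    (ha : ∀ i, MH (d i) (a i)) (hb : ∀ i, MH (d i) (b i)) (t0 : ℂ)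
    (h0 : Good (a + t0 • b)) : {t : ℂ | ¬ Good (a + t • b)}.Finite := by
  have hMH : ∀ t : ℂ, ∀ i, MH (d i) ((a + t • b) i) := fun t i => (ha i).add ((hb i).smul t)
  set F : Fin N → MvPolynomial (Sg k) (Polynomial ℂ) := fun i =>
    map Polynomial.C (a i) + C Polynomial.X * map Polynomial.C (b i) with hF
  have hFt : ∀ t i, map (Polynomial.evalRingHom t) (F i) = (a + t • b) i := by
    intro t i
    have hid : (Polynomial.evalRingHom t).comp Polynomial.C = RingHom.id ℂ := by ext; simp
    simp only [hF, map_add, map_mul, map_map, map_C, hid, map_id, Pi.add_apply, Pi.smul_apply]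
    simp [smul_eq_C_mul]
  set G : Fin N ⊕ Matrix (Sg k) (Fin N) ℂ → MvPolynomial (Sg k) (Polynomial ℂ) := fun s =>
    match s with
    | .inl i => F i
    | .inr R => Matrix.det (Matrix.of fun i i' => ∑ q, pderiv q (F i) * C (Polynomial.C (R q i')))
    with hG
  have hGl : ∀ t x i, eval x (map (Polynomial.evalRingHom t) (G (.inl i))) = ev (a + t • b) x i := by
    intro t x i
    show eval x (map (Polynomial.evalRingHom t) (F i)) = _
    rw [hFt]; rfl
  have hGr : ∀ t x R, eval x (map (Polynomial.evalRingHom t) (G (.inr R)))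
      = (JR (a + t • b) x R).det := by
    intro t x R
    show eval x (map (Polynomial.evalRingHom t) (Matrix.det _)) = _
    rw [RingHom.map_det, RingHom.map_det]
    congr 1
    ext i i'
    simp only [RingHom.mapMatrix_apply, Matrix.map_apply, Matrix.of_apply, JR, dE_apply, map_sum,
      map_mul, ← pderiv_map, hFt, map_C]
    simp
  clear_value G
  have hiff : ∀ t x, (∀ s, eval x (map (Polynomial.evalRingHom t) (G s)) = 0) ↔
      (ev (a + t • b) x = 0 ∧ ¬ Function.Surjective (jac (a + t • b) x)) := by
    intro t x
    rw [surj_iff]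
    push Not
    constructor
    · intro h
      refine ⟨?_, ?_⟩
      · funext i
        have h1 := h (.inl i)
        rw [hGl] at h1
        rw [h1, Pi.zero_apply]
      · intro R
        have h1 := h (.inr R)
        rw [hGr] at h1
        exact h1
    · rintro ⟨h1, h2⟩ (i | R)
      · rw [hGl, h1, Pi.zero_apply]
      · rw [hGr]; exact h2 R
  refine (elim G ?_ t0 ?_).subset ?_
  · intro t lam x hx hlam h
    rw [hiff] at h ⊢
    refine ⟨ev_scl (hMH t) lam x h.1, fun hs => h.2 ?_⟩
    have := surj_scl (hMH t) (fun j => (lam j)⁻¹) (fun j => inv_ne_zero (hlam j)) _ hs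
    convert this using 2
    congr 1
    funext q
    simp [scl, hlam]
  · intro x hx
    by_contra! hcon
    rw [hiff] at hcon
    exact hcon.2 (h0 x hx hcon.1)
  · intro t ht
    simp only [Good, Set.mem_ofPred_eq] at ht
    push Not at ht
    obtain ⟨x, hx, h1, h2⟩ := ht
    exact ⟨x, hx, (hiff t x).2 ⟨h1, h2⟩⟩

lemma Good.smul {f : Fin N → MvPolynomial (Sg k) ℂ} (hf : Good f) {c : ℂ} (hc : c ≠ 0) :
    Good (c • f) := by
  intro x hx h
  have h1 : ev f x = 0 := by
    funext i
    have := congrFun h i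
    simpa [ev, smul_eval, hc] using this
  intro y
  obtain ⟨v, hv⟩ := hf x hx h1 (c⁻¹ • y)
  refine ⟨v, ?_⟩
  funext i
  have := congrFun hv i
  rw [jac_apply] at this ⊢
  rw [Pi.smul_apply, dE_smul, smul_apply, this]
  simp [hc]

/-- generic small perturbation by a good system is good -/
theorem good_pert (a b : Fin N → MvPolynomial (Sg k) ℂ) (d : Fin N → Fin m → ℕ)
    (ha : ∀ i, MH (d i) (a i)) (hb : ∀ i, MH (d i) (b i)) (hgood : Good b) :
    {t : ℂ | t ≠ 0 ∧ ¬ Good (a + t • b)}.Finite := by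
  have h := good_line b a d hb ha 0 (by simpa using hgood)
  refine (h.image (fun t => t⁻¹)).subset ?_
  rintro t ⟨ht, hbad⟩
  refine ⟨t⁻¹, ?_, by simp⟩
  intro hg
  apply hbad
  have := hg.smul ht
  convert this using 1
  rw [smul_add, smul_smul, mul_inv_cancel₀ ht, one_smul, add_comm]

lemma eventually_of_finite {S : Set ℂ} (hS : {t : ℂ | t ≠ 0 ∧ t ∉ S}.Finite) :
    ∀ᶠ t in nhdsWithin (0:ℂ) {0}ᶜ, t ∈ S := by
  have h1 := hS.isClosed.isOpen_compl.mem_nhds (x := (0:ℂ)) (by simp)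
  filter_upwards [self_mem_nhdsWithin, mem_nhdsWithin_of_mem_nhds h1] with t ht ht'
  by_contra hcon
  exact ht' ⟨ht, hcon⟩

theorem good_pert' (a b : Fin N → MvPolynomial (Sg k) ℂ) (d : Fin N → Fin m → ℕ)
    (ha : ∀ i, MH (d i) (a i)) (hb : ∀ i, MH (d i) (b i)) (hgood : Good b) :
    ∀ᶠ t in nhdsWithin (0:ℂ) {0}ᶜ, Good (a + t • b) :=
  eventually_of_finite (S := {t | Good (a + t • b)}) (good_pert a b d ha hb hgood)

end MB

namespace MB
variable {m N : ℕ} {k : Fin m → ℕ}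

lemma oqm_mk (n : ℕ) : IsOpenQuotientMap
    (Projectivization.mk' ℂ : {v : Fin n → ℂ // v ≠ 0} → Projectivization ℂ (Fin n → ℂ)) := by
  refine ⟨Quot.mk_surjective, continuous_quot_mk, ?_⟩
  intro U hU
  have hq : Topology.IsQuotientMap (Projectivization.mk' ℂ : {v : Fin n → ℂ // v ≠ 0} →
    Projectivization ℂ (Fin n → ℂ)) := isQuotientMap_quot_mk
  rw [← hq.isOpen_preimage]
  have : (Projectivization.mk' ℂ) ⁻¹' ((Projectivization.mk' ℂ) '' U)
      = ⋃ a : ℂˣ, (fun v : {v : Fin n → ℂ // v ≠ 0} =>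
        (⟨a • v.1, (smul_ne_zero_iff_ne a).2 v.2⟩ : {v : Fin n → ℂ // v ≠ 0})) ⁻¹' U := by
    ext v
    simp only [Set.mem_preimage, Set.mem_image, Set.mem_iUnion]
    constructor
    · rintro ⟨u, hu, huv⟩
      rw [Projectivization.mk'_eq_mk, Projectivization.mk'_eq_mk,
        Projectivization.mk_eq_mk_iff] at huv
      obtain ⟨a, ha⟩ := huv
      refine ⟨a, ?_⟩
      convert hu
    · rintro ⟨a, ha⟩
      refine ⟨_, ha, ?_⟩
      rw [Projectivization.mk'_eq_mk, Projectivization.mk'_eq_mk,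
        Projectivization.mk_eq_mk_iff]
      exact ⟨a, rfl⟩
  rw [this]
  refine isOpen_iUnion fun a => hU.preimage ?_
  refine Continuous.subtype_mk ?_ _
  exact continuous_subtype_val.const_smul (a : ℂ)

instance compP (n : ℕ) : CompactSpace (Projectivization ℂ (Fin n → ℂ)) := by
  have hc : CompactSpace (Metric.sphere (0 : Fin n → ℂ) 1) :=
    isCompact_iff_compactSpace.1 (isCompact_sphere _ _)
  let g : Metric.sphere (0 : Fin n → ℂ) 1 → Projectivization ℂ (Fin n → ℂ) := fun v =>
    Projectivization.mk' ℂ ⟨v.1, by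
      have := v.2
      intro h
      rw [h] at this
      simp at this⟩
  have hg : Continuous g := (oqm_mk n).continuous.comp (Continuous.subtype_mk continuous_subtype_val _)
  have hs : Function.Surjective g := by
    intro P
    obtain ⟨⟨v, hv⟩, rfl⟩ := (oqm_mk n).surjective P
    have hn : ‖v‖ ≠ 0 := norm_ne_zero_iff.2 hv
    refine ⟨⟨((‖v‖ : ℂ)⁻¹) • v, by simp [norm_smul, hn]⟩, ?_⟩
    show Projectivization.mk' ℂ _ = _
    rw [Projectivization.mk'_eq_mk, Projectivization.mk'_eq_mk, Projectivization.mk_eq_mk_iff']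
    exact ⟨_, rfl⟩
  exact hs.compactSpace hg

instance t2P (n : ℕ) : T2Space (Projectivization ℂ (Fin n → ℂ)) := by
  rw [t2Space_iff_of_isOpenQuotientMap (oqm_mk n)]
  have : {q : {v : Fin n → ℂ // v ≠ 0} × {v : Fin n → ℂ // v ≠ 0} |
      Projectivization.mk' ℂ q.1 = Projectivization.mk' ℂ q.2}
      = ⋂ (i : Fin n) (j : Fin n), {q | q.1.1 i * q.2.1 j = q.1.1 j * q.2.1 i} := by
    ext ⟨⟨v, hv⟩, ⟨w, hw⟩⟩
    simp only [Set.mem_ofPred_eq, Set.mem_iInter]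
    rw [Projectivization.mk'_eq_mk, Projectivization.mk'_eq_mk, Projectivization.mk_eq_mk_iff']
    constructor
    · rintro ⟨a, rfl⟩ i j
      simp only [Pi.smul_apply, smul_eq_mul]; ring
    · intro h
      obtain ⟨j, hj⟩ := Function.ne_iff.1 hw
      rw [Pi.zero_apply] at hj
      refine ⟨v j / w j, ?_⟩
      funext i
      simp only [Pi.smul_apply, smul_eq_mul]
      field_simp
      rw [h j i, mul_comm]
  rw [this]
  refine isClosed_iInter fun i => isClosed_iInter fun j => isClosed_eq ?_ ?_
  · exact ((continuous_apply i).comp (continuous_subtype_val.comp continuous_fst)).mul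
      ((continuous_apply j).comp (continuous_subtype_val.comp continuous_snd))
  · exact ((continuous_apply j).comp (continuous_subtype_val.comp continuous_fst)).mul
      ((continuous_apply i).comp (continuous_subtype_val.comp continuous_snd))

/-- the product of projective spaces -/
abbrev PX {m : ℕ} (k : Fin m → ℕ) := ∀ j : Fin m, Projectivization ℂ (Fin (k j + 1) → ℂ)

/-- vectors with all groups nonzero -/
abbrev XN {m : ℕ} (k : Fin m → ℕ) := {x : Sg k → ℂ // NZ x}

lemma NZ.ne {x : Sg k → ℂ} (hx : NZ x) (j : Fin m) : (fun r => x ⟨j, r⟩) ≠ 0 := by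
  obtain ⟨r, hr⟩ := hx j
  intro h
  exact hr (congrFun h r)

/-- the projection -/
noncomputable def pr (x : XN k) : PX k := fun j => Projectivization.mk' ℂ ⟨fun r => x.1 ⟨j, r⟩, x.2.ne j⟩

/-- homeomorphism -/
def hom : XN k ≃ₜ (∀ j : Fin m, {v : Fin (k j + 1) → ℂ // v ≠ 0}) where
  toFun x j := ⟨fun r => x.1 ⟨j, r⟩, x.2.ne j⟩
  invFun v := ⟨fun q => (v q.1).1 q.2, fun j => by
    have := (v j).2
    obtain ⟨r, hr⟩ := Function.ne_iff.1 this
    exact ⟨r, hr⟩⟩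
  left_inv x := rfl
  right_inv v := rfl
  continuous_toFun := by
    refine continuous_pi fun j => Continuous.subtype_mk (continuous_pi fun r => ?_) _
    exact (continuous_apply _).comp continuous_subtype_val
  continuous_invFun := by
    refine Continuous.subtype_mk (continuous_pi fun q => ?_) _
    exact (continuous_apply q.2).comp (continuous_subtype_val.comp (continuous_apply q.1))

lemma oqm_pr : IsOpenQuotientMap (pr : XN k → PX k) := by
  have h := (IsOpenQuotientMap.piMap (fun j : Fin m => oqm_mk (k j + 1))).comp
    (hom (k := k)).isOpenQuotientMap
  exact h

lemma pr_eq_iff (x y : XN k) : pr x = pr y ↔ ∃ lam : Fin m → ℂ, (∀ j, lam j ≠ 0) ∧ x.1 = scl lam y.1 := by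
  constructor
  · intro h
    have : ∀ j, ∃ a : ℂˣ, a • (fun r => y.1 ⟨j, r⟩) = (fun r => x.1 ⟨j, r⟩) := fun j =>
      (Projectivization.mk_eq_mk_iff ℂ _ _ (x.2.ne j) (y.2.ne j)).1 (congrFun h j)
    choose a ha using this
    refine ⟨fun j => a j, fun j => (a j).ne_zero, ?_⟩
    funext ⟨j, r⟩
    exact (congrFun (ha j) r).symm
  · rintro ⟨lam, hl, h⟩
    funext j
    refine (Projectivization.mk_eq_mk_iff' ℂ _ _ (x.2.ne j) (y.2.ne j)).2 ⟨lam j, ?_⟩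
    funext r
    exact (congrFun h ⟨j, r⟩).symm

/-- representative -/
noncomputable def rp (P : PX k) : XN k := ⟨fun q => (P q.1).rep q.2, fun j => by
  obtain ⟨r, hr⟩ := Function.ne_iff.1 (P j).rep_nonzero
  exact ⟨r, hr⟩⟩

lemma pr_rp (P : PX k) : pr (rp P) = P := by
  funext j
  exact (P j).mk_rep

/-- zero set -/
def Zs (f : Fin N → MvPolynomial (Sg k) ℂ) : Set (PX k) := {P | ev f (rp P).1 = 0}

lemma mem_Zs {f : Fin N → MvPolynomial (Sg k) ℂ} {d : Fin N → Fin m → ℕ}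
    (hf : ∀ i, MH (d i) (f i)) (x : XN k) : pr x ∈ Zs f ↔ ev f x.1 = 0 := by
  obtain ⟨lam, hl, h⟩ := (pr_eq_iff _ _).1 (pr_rp (pr x))
  show ev f (rp (pr x)).1 = 0 ↔ _
  rw [h]
  constructor
  · intro h1
    have := ev_scl hf (fun j => (lam j)⁻¹) _ h1
    convert this using 2
    funext q
    simp [scl, hl]
  · exact ev_scl hf lam _

lemma closed_Zs {T : Type*} [TopologicalSpace T] (f : T → Fin N → MvPolynomial (Sg k) ℂ)
    (d : Fin N → Fin m → ℕ) (hf : ∀ t i, MH (d i) (f t i))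
    (hc : Continuous fun z : T × (Sg k → ℂ) => ev (f z.1) z.2) :
    IsClosed {z : T × PX k | z.2 ∈ Zs (f z.1)} := by
  have hq := (IsOpenQuotientMap.id (X := T)).prodMap (oqm_pr (k := k))
  rw [← hq.isQuotientMap.isClosed_preimage]
  have : Prod.map id pr ⁻¹' {z : T × PX k | z.2 ∈ Zs (f z.1)} =
      {z : T × XN k | ev (f z.1) z.2.1 = 0} := by
    ext z
    have := mem_Zs (hf z.1) z.2
    rw [Set.mem_preimage, Set.mem_ofPred_eq, Set.mem_ofPred_eq, Prod.map_snd, Prod.map_fst, id, this]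
  rw [this]
  have h1 : Continuous (fun z : T × XN k => (z.1, z.2.1)) :=
    continuous_fst.prodMk (continuous_subtype_val.comp continuous_snd)
  have h2 := hc.comp h1
  simp only [Function.comp_def] at h2
  exact isClosed_eq h2 continuous_const

lemma open_NZ : IsOpen {x : Sg k → ℂ | NZ x} := by
  have : {x : Sg k → ℂ | NZ x} = ⋂ j, ⋃ r, {x | x ⟨j, r⟩ ≠ 0} := by
    ext x; simp [NZ]
  rw [this]
  refine isOpen_iInter_of_finite fun j => isOpen_iUnion fun r => ?_
  exact isOpen_ne_fun (continuous_apply _) continuous_const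

end MB

namespace MB
variable {m N : ℕ} {k : Fin m → ℕ}

lemma mbij (hN : N = ∑ j, k j) (f : Fin N → MvPolynomial (Sg k) ℂ) (d : Fin N → Fin m → ℕ)
    (hf : ∀ i, MH (d i) (f i)) (p : Sg k → ℂ) (hz : ev f p = 0)
    (hs : Function.Surjective (jac f p)) (r : ∀ j, Fin (k j + 1)) (hr : ∀ j, p ⟨j, r j⟩ ≠ 0) :
    Function.Bijective (fun v : Sg k → ℂ => (jac f p v, fun j => v ⟨j, r j⟩)) := by
  let M : (Sg k → ℂ) →ₗ[ℂ] ((Fin N → ℂ) × (Fin m → ℂ)) :=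
    (jac f p : (Sg k → ℂ) →ₗ[ℂ] (Fin N → ℂ)).prod (LinearMap.pi fun j => LinearMap.proj ⟨j, r j⟩)
  have hsurj : Function.Surjective M := by
    rintro ⟨a, b⟩
    obtain ⟨v0, hv0⟩ := hs a
    refine ⟨v0 + ∑ j, ((b j - v0 ⟨j, r j⟩) / p ⟨j, r j⟩) • eul j p, ?_⟩
    apply Prod.ext
    · show jac f p _ = a
      rw [map_add, map_sum, hv0, Finset.sum_eq_zero, add_zero]
      intro j _
      rw [map_smul, jac_eul hf p hz j, smul_zero]
    · funext j
      show (v0 + ∑ j, ((b j - v0 ⟨j, r j⟩) / p ⟨j, r j⟩) • eul j p) ⟨j, r j⟩ = b j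
      rw [Pi.add_apply, Finset.sum_apply, Finset.sum_eq_single j]
      · simp only [Pi.smul_apply, eul, if_true, smul_eq_mul]
        rw [div_mul_cancel₀ _ (hr j)]; ring
      · intro b _ hb
        simp [eul, hb.symm]
      · simp
  have hfr : Module.finrank ℂ (Sg k → ℂ) = Module.finrank ℂ ((Fin N → ℂ) × (Fin m → ℂ)) := by
    rw [Module.finrank_prod, Module.finrank_fintype_fun_eq_card, Module.finrank_fintype_fun_eq_card,
      Module.finrank_fintype_fun_eq_card, Fintype.card_sigma]
    simp [Finset.sum_add_distrib, hN]
  exact ⟨(LinearMap.injective_iff_surjective_of_finrank_eq_finrank hfr).2 hsurj, hsurj⟩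

section loc
variable {T : Type*} [NormedAddCommGroup T] [NormedSpace ℂ T] [CompleteSpace T]

/-- auxiliary map -/
noncomputable def Psi (sys : T → Fin N → MvPolynomial (Sg k) ℂ) (r : ∀ j, Fin (k j + 1))
    (z : T × (Sg k → ℂ)) : T × ((Fin N → ℂ) × (Fin m → ℂ)) :=
  (z.1, (ev (sys z.1) z.2, fun j => z.2 ⟨j, r j⟩))

lemma Psi_strict (hN : N = ∑ j, k j) (sys : T → Fin N → MvPolynomial (Sg k) ℂ)
    (d : Fin N → Fin m → ℕ) (hf : ∀ t i, MH (d i) (sys t i))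
    (hC : ContDiff ℂ 1 (fun z : T × (Sg k → ℂ) => ev (sys z.1) z.2))
    (t0 : T) (p : Sg k → ℂ) (hz : ev (sys t0) p = 0)
    (hs : Function.Surjective (jac (sys t0) p)) (r : ∀ j, Fin (k j + 1))
    (hr : ∀ j, p ⟨j, r j⟩ ≠ 0) :
    ∃ L : (T × (Sg k → ℂ)) ≃L[ℂ] (T × ((Fin N → ℂ) × (Fin m → ℂ))),
      HasStrictFDerivAt (Psi sys r) (L : (T × (Sg k → ℂ)) →L[ℂ] (T × ((Fin N → ℂ) × (Fin m → ℂ))))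
        (t0, p) := by
  set F := fun z : T × (Sg k → ℂ) => ev (sys z.1) z.2 with hF
  have h1 : HasStrictFDerivAt F (fderiv ℂ F (t0, p)) (t0, p) :=
    hC.contDiffAt.hasStrictFDerivAt (by norm_num)
  set D := fderiv ℂ F (t0, p) with hD
  have hDj : ∀ v, D (0, v) = jac (sys t0) p v := by
    intro v
    have h2 : HasFDerivAt (fun x : Sg k → ℂ => (t0, x)) (ContinuousLinearMap.inr ℂ T (Sg k → ℂ)) p :=
      hasFDerivAt_prodMk_right t0 p
    have h3 := h1.hasFDerivAt.comp p h2
    have h4 := h3.unique (hasFDerivAt_ev (sys t0) p)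
    rw [← h4]; rfl
  let pj : (T × (Sg k → ℂ)) →L[ℂ] (Fin m → ℂ) := ContinuousLinearMap.pi fun j =>
    (ContinuousLinearMap.proj (R := ℂ) (φ := fun _ : Sg k => ℂ) ⟨j, r j⟩).comp
      (ContinuousLinearMap.snd ℂ T (Sg k → ℂ))
  let L := (ContinuousLinearMap.fst ℂ T (Sg k → ℂ)).prod (D.prod pj)
  have hL : HasStrictFDerivAt (Psi sys r) L (t0, p) := by
    refine hasStrictFDerivAt_fst.prodMk (h1.prodMk ?_)
    exact pj.hasStrictFDerivAt
  have hb := mbij hN (sys t0) d (hf t0) p hz hs r hr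
  have hdec : ∀ s v, D (s, v) = D (s, 0) + jac (sys t0) p v := by
    intro s v
    rw [← hDj, ← map_add]; simp
  have hbij : Function.Bijective L := by
    constructor
    · rw [injective_iff_map_eq_zero]
      rintro ⟨s, v⟩ h
      have hs0 : s = 0 := congrArg Prod.fst h
      subst hs0
      have h5 : D (0, v) = 0 := congrArg (fun z => z.2.1) h
      have h6 : (fun j => v ⟨j, r j⟩) = (0 : Fin m → ℂ) := congrArg (fun z => z.2.2) h
      rw [hDj] at h5
      have : v = 0 := by
        apply hb.1
        apply Prod.ext
        · simp only [h5, map_zero]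
        · simp only [h6]; rfl
      rw [this]; rfl
    · rintro ⟨s, a, b⟩
      obtain ⟨v, hv⟩ := hb.2 (a - D (s, 0), b)
      refine ⟨(s, v), ?_⟩
      have h5 : jac (sys t0) p v = a - D (s, 0) := congrArg Prod.fst hv
      have h6 : (fun j => v ⟨j, r j⟩) = b := congrArg Prod.snd hv
      apply Prod.ext
      · rfl
      · apply Prod.ext
        · show D (s, v) = a
          rw [hdec, h5]; abel
        · exact h6
  refine ⟨ContinuousLinearEquiv.ofBijective L (LinearMap.ker_eq_bot.2 hbij.1)
    (LinearMap.range_eq_top.2 hbij.2), ?_⟩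
  rw [ContinuousLinearEquiv.coe_ofBijective]
  exact hL

lemma pr_mem_nhds (x : XN k) {W : Set (PX k)} (hW : W ∈ nhds (pr x)) :
    ∀ᶠ y in nhds x.1, ∃ h : NZ y, pr ⟨y, h⟩ ∈ W := by
  have h1 : pr ⁻¹' W ∈ nhds x := oqm_pr.continuous.continuousAt hW
  rw [nhds_subtype_eq_comap, Filter.mem_comap] at h1
  obtain ⟨t, ht, hs⟩ := h1
  filter_upwards [ht, open_NZ.mem_nhds x.2] with y hy hn
  exact ⟨hn, hs (a := ⟨y, hn⟩) hy⟩

theorem loc_ex (hN : N = ∑ j, k j) (sys : T → Fin N → MvPolynomial (Sg k) ℂ)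
    (d : Fin N → Fin m → ℕ) (hf : ∀ t i, MH (d i) (sys t i))
    (hC : ContDiff ℂ 1 (fun z : T × (Sg k → ℂ) => ev (sys z.1) z.2))
    (t0 : T) (p : XN k) (hz : ev (sys t0) p.1 = 0)
    (hs : Function.Surjective (jac (sys t0) p.1)) (W : Set (PX k)) (hW : W ∈ nhds (pr p)) :
    ∀ᶠ t in nhds t0, ∃ Q ∈ W, Q ∈ Zs (sys t) := by
  choose r hr using p.2
  obtain ⟨L, hL⟩ := Psi_strict hN sys d hf hC t0 p.1 hz hs r hr
  have hm := hL.map_nhds_eq_of_equiv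
  have h1 : ∀ᶠ z in nhds (t0, p.1), ∃ h : NZ z.2, pr ⟨z.2, h⟩ ∈ W := by
    have : Filter.Tendsto (Prod.snd : T × (Sg k → ℂ) → _) (nhds (t0, p.1)) (nhds p.1) :=
      continuous_snd.continuousAt
    exact this.eventually (pr_mem_nhds p hW)
  have h2 := Filter.image_mem_map (m := Psi sys r) h1
  rw [hm] at h2
  have h3 : Filter.Tendsto (fun t : T => (t, ((0 : Fin N → ℂ), fun j => p.1 ⟨j, r j⟩))) (nhds t0)
      (nhds (Psi sys r (t0, p.1))) := by
    have : Psi sys r (t0, p.1) = (t0, ((0 : Fin N → ℂ), fun j => p.1 ⟨j, r j⟩)) := by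
      simp only [Psi, hz]
    rw [this]
    exact (continuous_id.prodMk continuous_const).continuousAt
  filter_upwards [h3 h2] with t ht
  obtain ⟨⟨s, x⟩, ⟨hx, hxW⟩, he⟩ := ht
  have hst : s = t := congrArg Prod.fst he
  have h0 : ev (sys s) x = 0 := congrArg (fun z => z.2.1) he
  rw [hst] at h0
  exact ⟨_, hxW, (mem_Zs (hf t) ⟨x, hx⟩).2 h0⟩

/-- normalization -/
noncomputable def nu (p : Sg k → ℂ) (r : ∀ j, Fin (k j + 1)) (x : Sg k → ℂ) : Sg k → ℂ :=
  scl (fun j => p ⟨j, r j⟩ / x ⟨j, r j⟩) x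

theorem loc_uniq (hN : N = ∑ j, k j) (sys : T → Fin N → MvPolynomial (Sg k) ℂ)
    (d : Fin N → Fin m → ℕ) (hf : ∀ t i, MH (d i) (sys t i))
    (hC : ContDiff ℂ 1 (fun z : T × (Sg k → ℂ) => ev (sys z.1) z.2))
    (t0 : T) (p : XN k) (hz : ev (sys t0) p.1 = 0)
    (hs : Function.Surjective (jac (sys t0) p.1)) :
    ∃ V ∈ nhds (pr p), ∀ᶠ t in nhds t0, ∀ Q ∈ V, ∀ Q' ∈ V, Q ∈ Zs (sys t) → Q' ∈ Zs (sys t) →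
      Q = Q' := by
  choose r hr using p.2
  obtain ⟨L, hL⟩ := Psi_strict hN sys d hf hC t0 p.1 hz hs r hr
  have hinj : ∃ S ∈ nhds (t0, p.1), Set.InjOn (Psi sys r) S :=
    ⟨_, (hL.toOpenPartialHomeomorph _).open_source.mem_nhds hL.mem_toOpenPartialHomeomorph_source,
      (hL.toOpenPartialHomeomorph _).injOn⟩
  obtain ⟨S, hS, hSi⟩ := hinj
  rw [nhds_prod_eq, Filter.mem_prod_iff] at hS
  obtain ⟨A, hA, B, hB, hAB⟩ := hS
  have hcont : ContinuousAt (nu p.1 r) p.1 := by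
    refine continuousAt_pi.2 fun q => ?_
    refine ContinuousAt.mul (ContinuousAt.div continuousAt_const (continuous_apply _).continuousAt (hr q.1)) (continuous_apply _).continuousAt
  have hnp : nu p.1 r p.1 = p.1 := by
    funext q
    simp [nu, scl, hr]
  have hev : ∀ᶠ x in nhds p.1, (∀ j, x ⟨j, r j⟩ ≠ 0) ∧ nu p.1 r x ∈ B := by
    refine Filter.Eventually.and (Filter.eventually_all.2 fun j => ?_) (hcont (by rwa [hnp]))
    exact (continuous_apply _).continuousAt.eventually_ne (hr j)
  have hev' : {x : XN k | (∀ j, x.1 ⟨j, r j⟩ ≠ 0) ∧ nu p.1 r x.1 ∈ B} ∈ nhds p :=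
    continuous_subtype_val.continuousAt hev
  refine ⟨pr '' {x : XN k | (∀ j, x.1 ⟨j, r j⟩ ≠ 0) ∧ nu p.1 r x.1 ∈ B},
    oqm_pr.isOpenMap.image_mem_nhds hev', ?_⟩
  filter_upwards [hA] with t ht
  rintro _ ⟨x, ⟨hx, hxB⟩, rfl⟩ _ ⟨y, ⟨hy, hyB⟩, rfl⟩ hzx hzy
  rw [mem_Zs (hf t)] at hzx hzy
  have h1 := ev_scl (hf t) (fun j => p.1 ⟨j, r j⟩ / x.1 ⟨j, r j⟩) x.1 hzx
  have h2 := ev_scl (hf t) (fun j => p.1 ⟨j, r j⟩ / y.1 ⟨j, r j⟩) y.1 hzy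
  have h3 : nu p.1 r x.1 = nu p.1 r y.1 := by
    have : Psi sys r (t, nu p.1 r x.1) = Psi sys r (t, nu p.1 r y.1) := by
      simp only [Psi, nu, h1, h2]
      congr 2
      funext j
      simp only [scl]
      rw [div_mul_cancel₀ _ (hx j), div_mul_cancel₀ _ (hy j)]
    exact congrArg Prod.snd (hSi (hAB (Set.mk_mem_prod ht hxB)) (hAB (Set.mk_mem_prod ht hyB)) this)
  rw [pr_eq_iff]
  refine ⟨fun j => (x.1 ⟨j, r j⟩ / p.1 ⟨j, r j⟩) * (p.1 ⟨j, r j⟩ / y.1 ⟨j, r j⟩), fun j =>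
    mul_ne_zero (div_ne_zero (hx j) (hr j)) (div_ne_zero (hr j) (hy j)), ?_⟩
  funext q
  have h4 := congrFun h3 q
  simp only [nu, scl] at h4 ⊢
  rw [mul_assoc, ← h4]
  have := hx q.1
  have := hr q.1
  field_simp

end loc
end MB

namespace MB

section abstractcount
variable {T X : Type*} [TopologicalSpace T] [TopologicalSpace X] [CompactSpace X] [T2Space X]

/-- local structure of a zero -/
def LocNice (Z : T → Set X) (t0 : T) (P : X) : Prop :=
  (∀ W ∈ nhds P, ∀ᶠ t in nhds t0, ∃ Q ∈ W, Q ∈ Z t) ∧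
  ∃ V ∈ nhds P, ∀ᶠ t in nhds t0, ∀ Q ∈ V, ∀ Q' ∈ V, Q ∈ Z t → Q' ∈ Z t → Q = Q'

theorem count_local (Z : T → Set X) (hZ : IsClosed {z : T × X | z.2 ∈ Z z.1}) (U : Set X)
    (hU : IsOpen U) (t0 : T) (hb : Z t0 ∩ closure U ⊆ U)
    (hn : ∀ P ∈ Z t0 ∩ U, LocNice Z t0 P) :
    ∀ᶠ t in nhds t0, (Z t ∩ U).encard = (Z t0 ∩ U).encard := by
  have hZ0 : IsClosed (Z t0) := hZ.preimage (Continuous.prodMk_right t0)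
  have hSe : Z t0 ∩ U = Z t0 ∩ closure U := by
    ext x
    exact ⟨fun h => ⟨h.1, subset_closure h.2⟩, fun h => ⟨h.1, hb h⟩⟩
  have hSc : IsCompact (Z t0 ∩ U) := by
    rw [hSe]; exact (hZ0.inter isClosed_closure).isCompact
  choose! hex V hV hVu using hn
  have hSf : (Z t0 ∩ U).Finite := by
    obtain ⟨F, hF, hFc⟩ := hSc.elim_nhds_subcover V hV
    have : Z t0 ∩ U ⊆ ⋃ x ∈ (F : Set X), (V x ∩ Z t0) := by
      intro x hx
      obtain ⟨y, hy, hxy⟩ := Set.mem_iUnion₂.1 (hFc hx)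
      exact Set.mem_iUnion₂.2 ⟨y, hy, hxy, hx.1⟩
    refine Set.Finite.subset (Set.Finite.biUnion F.finite_toSet fun x hx => ?_) this
    apply Set.Subsingleton.finite
    intro a ha b hb
    exact (hVu x (hF x hx)).self_of_nhds a ha.1 b hb.1 ha.2 hb.2
  obtain ⟨O, hO, hOd⟩ := hSf.t2_separation
  let W : X → Set X := fun x => interior (V x) ∩ O x ∩ U
  have hWo : ∀ x, IsOpen (W x) := fun x => (isOpen_interior.inter (hO x).2).inter hU
  have hWm : ∀ x ∈ Z t0 ∩ U, x ∈ W x := fun x hx =>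
    ⟨⟨mem_interior_iff_mem_nhds.2 (hV x hx), (hO x).1⟩, hx.2⟩
  let K := closure U \ ⋃ x ∈ Z t0 ∩ U, W x
  have hK : IsCompact K :=
    (isClosed_closure.inter (isOpen_biUnion fun x _ => hWo x).isClosed_compl).isCompact
  have h1 : ∀ᶠ t in nhds t0, ∀ y ∈ K, y ∉ Z t := by
    apply hK.eventually_forall_of_forall_eventually (P := fun t y => y ∉ Z t)
    intro y hy
    refine hZ.isOpen_compl.mem_nhds ?_
    intro h
    have : y ∈ Z t0 ∩ U := by rw [hSe]; exact ⟨h, hy.1⟩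
    exact hy.2 (Set.mem_biUnion this (hWm y this))
  have h2 : ∀ᶠ t in nhds t0, ∀ x ∈ Z t0 ∩ U, ∃ Q ∈ W x, Q ∈ Z t := by
    rw [Filter.eventually_all_finite hSf]
    intro x hx
    exact hex x hx (W x) ((hWo x).mem_nhds (hWm x hx))
  have h3 : ∀ᶠ t in nhds t0, ∀ x ∈ Z t0 ∩ U, ∀ Q ∈ V x, ∀ Q' ∈ V x, Q ∈ Z t → Q' ∈ Z t → Q = Q' := by
    rw [Filter.eventually_all_finite hSf]
    intro x hx
    exact hVu x hx
  filter_upwards [h1, h2, h3] with t ht1 ht2 ht3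
  choose! φ hφ hφZ using ht2
  have hinj : Set.InjOn φ (Z t0 ∩ U) := by
    intro a ha b hb hab
    by_contra hne
    have := hOd ha hb hne
    exact Set.disjoint_left.1 this (hφ a ha).1.2 (hab ▸ (hφ b hb).1.2)
  rw [← hinj.encard_image]
  congr 1
  ext y
  constructor
  · rintro ⟨hy, hyU⟩
    have : y ∈ ⋃ x ∈ Z t0 ∩ U, W x := by
      by_contra h
      exact ht1 y ⟨subset_closure hyU, h⟩ hy
    obtain ⟨x, hx, hyx⟩ := Set.mem_iUnion₂.1 this
    exact ⟨x, hx, ht3 x hx _ (interior_subset (hφ x hx).1.1) _ (interior_subset hyx.1.1) (hφZ x hx) hy⟩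
  · rintro ⟨x, hx, rfl⟩
    exact ⟨hφZ x hx, (hφ x hx).2⟩

theorem count_const (Z : T → Set X) (hZ : IsClosed {z : T × X | z.2 ∈ Z z.1}) (U : Set X)
    (hU : IsOpen U) (S : Set T) (hS : IsPreconnected S) (hb : ∀ t ∈ S, Z t ∩ closure U ⊆ U)
    (hn : ∀ t ∈ S, ∀ P ∈ Z t ∩ U, LocNice Z t P) (a b : T) (ha : a ∈ S) (hbS : b ∈ S) :
    (Z a ∩ U).encard = (Z b ∩ U).encard := by
  let _ : TopologicalSpace ℕ∞ := ⊥
  have : DiscreteTopology ℕ∞ := ⟨rfl⟩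
  refine hS.constant (f := fun t => (Z t ∩ U).encard) ?_ ha hbS
  intro t ht
  apply ContinuousAt.continuousWithinAt
  rw [ContinuousAt, nhds_discrete ℕ∞, Filter.tendsto_pure]
  exact count_local Z hZ U hU t (hb t ht) (hn t ht)

end abstractcount

theorem path_lemma (bad : Set ℂ) (hbad : bad.Finite) (h0 : (0 : ℂ) ∉ bad) (h1 : (1 : ℂ) ∉ bad)
    (W : Set ℂ) (hW : IsOpen W) (hseg : ∀ u : ℝ, 0 ≤ u → u ≤ 1 → (u : ℂ) ∈ W) :
    ∃ S : Set ℂ, IsPreconnected S ∧ S ⊆ W ∧ Disjoint S bad ∧ (0 : ℂ) ∈ S ∧ (1 : ℂ) ∈ S := by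
  let γ : ℝ → ℝ → ℂ := fun c u => ⟨u, c * (u * (1 - u))⟩
  have hγc : Continuous (fun z : ℝ × ℝ => γ z.1 z.2) := by
    have : (fun z : ℝ × ℝ => γ z.1 z.2) = fun z => ((z.2 : ℂ) + ((z.1 * (z.2 * (1 - z.2)) : ℝ) : ℂ) * Complex.I) := by
      funext z
      apply Complex.ext <;> simp [γ]
    rw [this]
    fun_prop
  have hW' : ∀ᶠ c in nhds (0 : ℝ), ∀ u ∈ Set.Icc (0 : ℝ) 1, γ c u ∈ W := by
    apply isCompact_Icc.eventually_forall_of_forall_eventually (P := fun c u => γ c u ∈ W)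
    intro u hu
    refine (hW.preimage hγc).mem_nhds ?_
    have : γ 0 u = (u : ℂ) := by apply Complex.ext <;> simp [γ]
    show γ 0 u ∈ W
    rw [this]
    exact hseg u hu.1 hu.2
  let F : Set ℝ := (fun b : ℂ => b.im / (b.re * (1 - b.re))) '' bad
  have hF : F.Finite := hbad.image _
  have hF' : ∀ᶠ c in nhds (0 : ℝ), c ∉ F \ {0} :=
    (hF.subset Set.sdiff_subset).isClosed.isOpen_compl.mem_nhds (by simp)
  have hne : ∃ᶠ c in nhds (0 : ℝ), c ≠ 0 := by
    have h := NormedField.nhdsNE_neBot (0 : ℝ)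
    have h2 : ∃ᶠ c in nhdsWithin (0 : ℝ) {0}ᶜ, c ∈ ({0}ᶜ : Set ℝ) :=
      Filter.Eventually.frequently eventually_mem_nhdsWithin
    exact (frequently_nhdsWithin_iff.1 h2).mono fun x hx => hx.2
  obtain ⟨c, hc0, hcW, hcF⟩ := (hne.and_eventually (hW'.and hF')).exists
  refine ⟨γ c '' Set.Icc 0 1, ?_, ?_, ?_, ?_, ?_⟩
  · refine isPreconnected_Icc.image _ (Continuous.continuousOn ?_)
    exact hγc.comp (Continuous.prodMk_right c)
  · rintro _ ⟨u, hu, rfl⟩; exact hcW u hu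
  · rw [Set.disjoint_left]
    rintro _ ⟨u, hu, rfl⟩ hb
    have hu0 : u ≠ 0 := by
      rintro rfl
      apply h0
      convert hb using 1
      apply Complex.ext <;> simp [γ]
    have hu1 : 1 - u ≠ 0 := by
      intro h
      have hu' : u = 1 := by linarith
      subst hu'
      apply h1
      convert hb using 1
      apply Complex.ext <;> simp [γ]
    apply hcF
    refine ⟨⟨_, hb, ?_⟩, hc0⟩
    show c * (u * (1 - u)) / (u * (1 - u)) = c
    field_simp
  · exact ⟨0, by simp, by apply Complex.ext <;> simp [γ]⟩
  · exact ⟨1, by simp, by apply Complex.ext <;> simp [γ]⟩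

end MB

namespace MB
variable {m N : ℕ} {k : Fin m → ℕ}

/-- nodes -/
noncomputable def al (i : Fin N) (l : ℕ) : ℂ := ((Nat.pair (i : ℕ) l : ℕ) : ℂ)

lemma al_inj {i i' : Fin N} {l l' : ℕ} (h : al i l = al i' l') : i = i' ∧ l = l' := by
  have h1 : Nat.pair (i : ℕ) l = Nat.pair (i' : ℕ) l' := by
    rw [al, al] at h
    exact_mod_cast h
  rw [Nat.pair_eq_pair] at h1
  exact ⟨Fin.ext h1.1, h1.2⟩

/-- linear forms -/
noncomputable def Lf (j : Fin m) (a : ℂ) : MvPolynomial (Sg k) ℂ :=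
  ∑ r : Fin (k j + 1), (a ^ (r : ℕ)) • X ⟨j, r⟩

lemma eval_Lf (j : Fin m) (a : ℂ) (x : Sg k → ℂ) :
    eval x (Lf j a) = ∑ r : Fin (k j + 1), a ^ (r : ℕ) * x ⟨j, r⟩ := by
  simp [Lf, smul_eval]

lemma MH_Lf (j : Fin m) (a : ℂ) : MH (Pi.single j 1) (Lf (k := k) j a) := by
  intro lam x
  have : ∏ j', lam j' ^ (Pi.single j 1 : Fin m → ℕ) j' = lam j := by
    rw [Finset.prod_eq_single j]
    · simp
    · intro b _ hb; simp [hb]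
    · simp
  rw [this, eval_Lf, eval_Lf, Finset.mul_sum]
  refine Finset.sum_congr rfl fun r _ => ?_
  simp only [scl]; ring

lemma dE_Lf (j : Fin m) (a : ℂ) (x v : Sg k → ℂ) : dE (Lf j a) x v = eval v (Lf j a) := by
  let Φ : (Sg k → ℂ) →L[ℂ] ℂ := ∑ r : Fin (k j + 1), (a ^ (r : ℕ)) •
    ContinuousLinearMap.proj (R := ℂ) (φ := fun _ : Sg k => ℂ) ⟨j, r⟩
  have h1 : (fun y : Sg k → ℂ => eval y (Lf j a)) = Φ := by
    funext y
    rw [eval_Lf]; simp [Φ]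
  have h2 := hasFDerivAt_eval (Lf j a) x
  rw [h1] at h2
  have h3 := h2.unique Φ.hasFDerivAt
  rw [h3, ← h1]

/-- the start system -/
noncomputable def start (d : Fin N → Fin m → ℕ) (i : Fin N) : MvPolynomial (Sg k) ℂ :=
  ∏ c : (Σ j : Fin m, Fin (d i j)), Lf c.1 (al i c.2)

lemma MH_start (d : Fin N → Fin m → ℕ) (i : Fin N) : MH (d i) (start (k := k) d i) := by
  have := MH.prod (k := k) Finset.univ (fun c : (Σ j : Fin m, Fin (d i j)) => Pi.single c.1 1)
    (fun c => Lf c.1 (al i c.2)) (fun c _ => MH_Lf _ _)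
  convert this using 1
  swap
  · rfl
  funext j
  rw [Finset.sum_apply, Fintype.sum_sigma, Finset.sum_eq_single j]
  · simp
  · intro b _ hb; simp [hb.symm]
  · simp

/-- choices -/
abbrev Cx (d : Fin N → Fin m → ℕ) := ∀ i : Fin N, Σ j : Fin m, Fin (d i j)

/-- the node of a choice -/
noncomputable def nd {d : Fin N → Fin m → ℕ} (c : Cx d) (i : Fin N) : ℂ := al i (c i).2

lemma nd_inj {d : Fin N → Fin m → ℕ} (c : Cx d) : Function.Injective (nd c) := by
  intro i i' h
  exact (al_inj h).1

/-- validity of a choice -/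
def Val {d : Fin N → Fin m → ℕ} (x : Sg k → ℂ) (c : Cx d) : Prop :=
  ∀ i, eval x (Lf (c i).1 (nd c i)) = 0

lemma ev_start_iff (d : Fin N → Fin m → ℕ) (x : Sg k → ℂ) :
    ev (start d) x = 0 ↔ ∃ c : Cx d, Val x c := by
  constructor
  · intro h
    have : ∀ i, ∃ c : (Σ j : Fin m, Fin (d i j)), eval x (Lf c.1 (al i c.2)) = 0 := by
      intro i
      have h1 := congrFun h i
      simp only [ev, start, map_prod, Pi.zero_apply] at h1
      obtain ⟨c, _, hc⟩ := Finset.prod_eq_zero_iff.1 h1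
      exact ⟨c, hc⟩
    choose c hc using this
    exact ⟨c, hc⟩
  · rintro ⟨c, hc⟩
    funext i
    simp only [ev, start, map_prod, Pi.zero_apply]
    exact Finset.prod_eq_zero (Finset.mem_univ (c i)) (hc i)

/-- the univariate polynomial of a group -/
noncomputable def pj (x : Sg k → ℂ) (j : Fin m) : Polynomial ℂ :=
  ∑ r : Fin (k j + 1), Polynomial.C (x ⟨j, r⟩) * Polynomial.X ^ (r : ℕ)

lemma pj_coeff (x : Sg k → ℂ) (j : Fin m) (r : Fin (k j + 1)) : (pj x j).coeff r = x ⟨j, r⟩ := by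
  simp only [pj, Polynomial.finsetSum_coeff, Polynomial.coeff_C_mul_X_pow]
  rw [Finset.sum_eq_single r]
  · simp
  · intro b _ hb
    rw [if_neg]
    intro h; exact hb (Fin.ext h.symm)
  · simp

lemma pj_deg (x : Sg k → ℂ) (j : Fin m) : (pj x j).natDegree ≤ k j := by
  refine Polynomial.natDegree_sum_le_of_forall_le _ _ fun r _ => ?_
  exact (Polynomial.natDegree_C_mul_X_pow_le _ _).trans (Nat.lt_succ_iff.1 r.2)

lemma pj_eval (x : Sg k → ℂ) (j : Fin m) (a : ℂ) : (pj x j).eval a = eval x (Lf j a) := by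
  rw [eval_Lf]
  rw [pj, Polynomial.eval_finsetSum]
  refine Finset.sum_congr rfl fun r _ => ?_
  rw [Polynomial.eval_mul, Polynomial.eval_pow, Polynomial.eval_C, Polynomial.eval_X, mul_comm]

lemma pj_ne (x : Sg k → ℂ) (hx : NZ x) (j : Fin m) : pj x j ≠ 0 := by
  obtain ⟨r, hr⟩ := hx j
  intro h
  apply hr
  rw [← pj_coeff x, h, Polynomial.coeff_zero]

/-- the polynomial of a choice -/
noncomputable def qc {d : Fin N → Fin m → ℕ} (c : Cx d) (j : Fin m) : Polynomial ℂ :=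
  ∏ i with (c i).1 = j, (Polynomial.X - Polynomial.C (nd c i))

lemma qc_monic {d : Fin N → Fin m → ℕ} (c : Cx d) (j : Fin m) : (qc c j).Monic :=
  Polynomial.monic_prod_of_monic _ _ fun i _ => Polynomial.monic_X_sub_C _

lemma qc_deg {d : Fin N → Fin m → ℕ} (c : Cx d) (j : Fin m) :
    (qc c j).natDegree = (Finset.univ.filter fun i => (c i).1 = j).card := by
  rw [qc, Polynomial.natDegree_prod_of_monic _ _ fun i _ => Polynomial.monic_X_sub_C _]
  simp

lemma qc_dvd {d : Fin N → Fin m → ℕ} (c : Cx d) (x : Sg k → ℂ) (h : Val x c) (j : Fin m) :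
    qc c j ∣ pj x j := by
  refine Finset.prod_dvd_of_coprime ?_ ?_
  · intro i _ i' _ hne
    exact Polynomial.pairwise_coprime_X_sub_C (nd_inj c) hne
  · intro i hi
    have hi' : (c i).1 = j := by simpa using hi
    rw [Polynomial.dvd_iff_isRoot, Polynomial.IsRoot, pj_eval, ← hi']
    exact h i

lemma card_eq (hN : N = ∑ j, k j) {d : Fin N → Fin m → ℕ} (c : Cx d) (x : Sg k → ℂ) (hx : NZ x)
    (h : Val x c) (j : Fin m) : (Finset.univ.filter fun i => (c i).1 = j).card = k j := by
  have hle : ∀ j ∈ Finset.univ, (Finset.univ.filter fun i => (c i).1 = j).card ≤ k j := by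
    intro j _
    rw [← qc_deg]
    exact (Polynomial.natDegree_le_of_dvd (qc_dvd c x h j) (pj_ne x hx j)).trans (pj_deg x j)
  have hs : ∑ j, (Finset.univ.filter fun i => (c i).1 = j).card = ∑ j, k j := by
    rw [← hN, ← Finset.card_eq_sum_card_fiberwise (f := fun i => (c i).1) (fun _ _ => by simp)]
    simp
  exact (Finset.sum_eq_sum_iff_of_le hle).1 hs j (Finset.mem_univ j)

lemma pj_eq (hN : N = ∑ j, k j) {d : Fin N → Fin m → ℕ} (c : Cx d) (x : Sg k → ℂ) (hx : NZ x)
    (h : Val x c) (j : Fin m) : ∃ a : ℂ, a ≠ 0 ∧ pj x j = Polynomial.C a * qc c j := by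
  refine ⟨(pj x j).leadingCoeff, Polynomial.leadingCoeff_ne_zero.2 (pj_ne x hx j), ?_⟩
  refine Polynomial.eq_leadingCoeff_mul_of_monic_of_dvd_of_natDegree_le (qc_monic c j)
    (qc_dvd c x h j) ?_
  rw [qc_deg, card_eq hN c x hx h]
  exact pj_deg x j

/-- only the chosen factor vanishes -/
lemma val_uniq (hN : N = ∑ j, k j) {d : Fin N → Fin m → ℕ} (c : Cx d) (x : Sg k → ℂ) (hx : NZ x)
    (h : Val x c) (i : Fin N) (b : Σ j : Fin m, Fin (d i j))
    (hb : eval x (Lf b.1 (al i b.2)) = 0) : b = c i := by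
  obtain ⟨a, ha, hp⟩ := pj_eq hN c x hx h b.1
  rw [← pj_eval, hp, Polynomial.eval_mul, Polynomial.eval_C, qc, Polynomial.eval_prod,
    mul_eq_zero, or_iff_right ha, Finset.prod_eq_zero_iff] at hb
  obtain ⟨i', hi', he⟩ := hb
  rw [Polynomial.eval_sub, Polynomial.eval_X, Polynomial.eval_C, sub_eq_zero] at he
  obtain ⟨h1, h2⟩ := al_inj he
  subst h1
  have h3 : (c i).1 = b.1 := by simpa using hi'
  revert h2 h3
  obtain ⟨j, l⟩ := b
  generalize c i = e
  obtain ⟨j', l'⟩ := e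
  intro h2 h3
  dsimp at h2 h3
  subst h3
  congr 1
  exact Fin.ext h2

theorem start_good (hN : N = ∑ j, k j) (d : Fin N → Fin m → ℕ) : Good (start (k := k) d) := by
  classical
  intro x hx h0
  obtain ⟨c, hc⟩ := (ev_start_iff d x).1 h0
  have hdE : ∀ i v, dE (start d i) x v =
      (∏ b ∈ Finset.univ.erase (c i), eval x (Lf b.1 (al i b.2))) * eval v (Lf (c i).1 (nd c i)) := by
    intro i v
    have : start (k := k) d i = (∏ b ∈ Finset.univ.erase (c i), Lf b.1 (al i b.2)) *
        Lf (c i).1 (nd c i) := by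
      rw [start, ← Finset.prod_erase_mul _ _ (Finset.mem_univ (c i))]; rfl
    rw [this, dE_mul, hc i, add_apply, smul_apply, smul_apply, dE_Lf, map_prod, smul_eq_mul,
      smul_eq_mul, zero_mul, add_zero]
  have hne : ∀ i, (∏ b ∈ Finset.univ.erase (c i), eval x (Lf (k := k) b.1 (al i b.2))) ≠ 0 := by
    intro i
    refine Finset.prod_ne_zero_iff.2 fun b hb h => ?_
    exact (Finset.mem_erase.1 hb).1 (val_uniq hN c x hx hc i b h)
  intro y
  let w : Fin N → ℂ := fun i => (∏ b ∈ Finset.univ.erase (c i), eval x (Lf (k := k) b.1 (al i b.2)))⁻¹ * y i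
  let q : Fin m → Polynomial ℂ := fun j => Lagrange.interpolate (Finset.univ.filter fun i => (c i).1 = j) (nd c) w
  refine ⟨fun s => (q s.1).coeff s.2, ?_⟩
  funext i
  rw [jac_apply, hdE]
  have hq : pj (k := k) (fun s => (q s.1).coeff s.2) (c i).1 = q (c i).1 := by
    ext n
    by_cases hn : n < k (c i).1 + 1
    · exact pj_coeff (k := k) _ (c i).1 ⟨n, hn⟩
    · rw [Polynomial.coeff_eq_zero_of_natDegree_lt (lt_of_le_of_lt (pj_deg _ _) (by omega))]
      symm
      apply Polynomial.coeff_eq_zero_of_degree_lt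
      refine lt_of_lt_of_le (Lagrange.degree_interpolate_lt w ((nd_inj c).injOn)) ?_
      rw [card_eq hN c x hx hc]
      exact_mod_cast (by omega)
  rw [← pj_eval, hq, Lagrange.eval_interpolate_at_node w ((nd_inj c).injOn) (by simp)]
  simp only [w]
  rw [← mul_assoc, mul_inv_cancel₀ (hne i), one_mul]

/-- the vector of a choice -/
noncomputable def xc {d : Fin N → Fin m → ℕ} (c : Cx d) : Sg k → ℂ := fun s => (qc c s.1).coeff s.2

lemma pj_xc {d : Fin N → Fin m → ℕ} (c : Cx d)
    (hc : ∀ j, (Finset.univ.filter fun i => (c i).1 = j).card = k j) (j : Fin m) :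
    pj (xc (k := k) c) j = qc c j := by
  ext n
  by_cases hn : n < k j + 1
  · exact pj_coeff (k := k) _ j ⟨n, hn⟩
  · rw [Polynomial.coeff_eq_zero_of_natDegree_lt (lt_of_le_of_lt (pj_deg _ _) (by omega)),
      Polynomial.coeff_eq_zero_of_natDegree_lt]
    rw [qc_deg, hc]; omega

lemma NZ_xc {d : Fin N → Fin m → ℕ} (c : Cx d)
    (hc : ∀ j, (Finset.univ.filter fun i => (c i).1 = j).card = k j) : NZ (xc (k := k) c) := by
  intro j
  refine ⟨Fin.last _, ?_⟩
  show (qc c j).coeff (k j) ≠ 0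
  have := qc_monic c j
  rw [Polynomial.Monic, Polynomial.leadingCoeff, qc_deg, hc] at this
  rw [this]; exact one_ne_zero

lemma Val_xc {d : Fin N → Fin m → ℕ} (c : Cx d)
    (hc : ∀ j, (Finset.univ.filter fun i => (c i).1 = j).card = k j) : Val (xc (k := k) c) c := by
  intro i
  rw [← pj_eval, pj_xc c hc, qc, Polynomial.eval_prod]
  refine Finset.prod_eq_zero (i := i) (by simp) (by simp)

lemma Val.scl {d : Fin N → Fin m → ℕ} {c : Cx d} {x : Sg k → ℂ} (h : Val x c) (lam : Fin m → ℂ) :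
    Val (scl lam x) c := by
  intro i
  rw [MH_Lf, h i, mul_zero]

theorem start_card (hN : N = ∑ j, k j) (d : Fin N → Fin m → ℕ) :
    (Zs (start (k := k) d)).encard =
      ({c : Cx d | ∀ j, (Finset.univ.filter fun i => (c i).1 = j).card = k j}).encard := by
  classical
  set S := {c : Cx d | ∀ j, (Finset.univ.filter fun i => (c i).1 = j).card = k j} with hS
  let φ : S → PX k := fun c => pr ⟨xc c.1, NZ_xc c.1 c.2⟩
  have hinj : Function.Injective φ := by
    rintro ⟨c, hc⟩ ⟨c', hc'⟩ h
    obtain ⟨lam, hl, hx⟩ := (pr_eq_iff _ _).1 h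
    have h1 : Val (xc (k := k) c) c' := by
      have := (Val_xc (k := k) c' hc').scl lam
      rwa [← hx] at this
    apply Subtype.ext
    funext i
    exact val_uniq hN c' _ (NZ_xc c hc) h1 i (c i) (Val_xc c hc i)
  have hr : Set.range φ = Zs (start (k := k) d) := by
    ext P
    constructor
    · rintro ⟨⟨c, hc⟩, rfl⟩
      rw [mem_Zs (MH_start d), ev_start_iff]
      exact ⟨c, Val_xc c hc⟩
    · intro hP
      rw [← pr_rp P, mem_Zs (MH_start d), ev_start_iff] at hP
      obtain ⟨c, hv⟩ := hP
      have hc := card_eq hN c _ (rp P).2 hv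
      refine ⟨⟨c, hc⟩, ?_⟩
      rw [← pr_rp P]
      symm
      rw [pr_eq_iff]
      choose a ha hp using pj_eq hN c _ (rp P).2 hv
      refine ⟨a, ha, ?_⟩
      funext ⟨j, r⟩
      show _ = a j * (qc c j).coeff r
      rw [← pj_coeff (rp P).1, hp j, Polynomial.coeff_C_mul]
  rw [← hr, ← Set.image_univ, hinj.encard_image, Set.encard_univ]
  rfl

theorem bez_card (d : Fin N → Fin m → ℕ) :
    ({c : Cx d | ∀ j, (Finset.univ.filter fun i => (c i).1 = j).card = k j}).encard =
    ((coeff (Finsupp.equivFunOnFinite.symm k)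
      (∏ i : Fin N, ∑ j : Fin m, (C (d i j) * X j : MvPolynomial (Fin m) ℕ)) : ℕ) : ℕ∞) := by
  classical
  have h1 : ∀ i, ∑ j : Fin m, (C (d i j) * X j : MvPolynomial (Fin m) ℕ) =
      ∑ c : (Σ j : Fin m, Fin (d i j)), X c.1 := by
    intro i
    rw [Fintype.sum_sigma]
    refine Finset.sum_congr rfl fun j _ => ?_
    simp
  simp only [h1]
  rw [Finset.prod_univ_sum, coeff_sum]
  have h2 : ∀ c : Cx d, coeff (Finsupp.equivFunOnFinite.symm k)
      (∏ i, (X (c i).1 : MvPolynomial (Fin m) ℕ)) =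
      if (∀ j, (Finset.univ.filter fun i => (c i).1 = j).card = k j) then 1 else 0 := by
    intro c
    have : (∏ i, (X (c i).1 : MvPolynomial (Fin m) ℕ)) =
        monomial (∑ i, Finsupp.single (c i).1 1) 1 := by
      rw [monomial_sum_one]; rfl
    rw [this, coeff_monomial]
    congr 1
    rw [Finsupp.ext_iff, eq_iff_iff]
    refine forall_congr' fun j => ?_
    rw [Finsupp.finsetSum_apply, Finset.card_filter]
    simp [Finsupp.single_apply]
  simp only [h2]
  rw [Finset.sum_boole, Set.encard_eq_coe_toFinset_card]
  simp

end MB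

namespace MB
variable {m N : ℕ} {k : Fin m → ℕ}

lemma locnice {T : Type*} [NormedAddCommGroup T] [NormedSpace ℂ T] [CompleteSpace T]
    (hN : N = ∑ j, k j) (sys : T → Fin N → MvPolynomial (Sg k) ℂ)
    (d : Fin N → Fin m → ℕ) (hf : ∀ t i, MH (d i) (sys t i))
    (hC : ContDiff ℂ 1 (fun z : T × (Sg k → ℂ) => ev (sys z.1) z.2))
    (t0 : T) (hg : Good (sys t0)) (P : PX k) (hP : P ∈ Zs (sys t0)) :
    LocNice (fun t => Zs (sys t)) t0 P := by
  have hs := hg (rp P).1 (rp P).2 hP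
  have h1 := loc_ex hN sys d hf hC t0 (rp P) hP hs
  have h2 := loc_uniq hN sys d hf hC t0 (rp P) hP hs
  rw [pr_rp] at h1 h2
  exact ⟨h1, h2⟩

lemma contDiff_line (a b : Fin N → MvPolynomial (Sg k) ℂ) :
    ContDiff ℂ 1 (fun z : ℂ × (Sg k → ℂ) => ev (a + z.1 • b) z.2) := by
  have : (fun z : ℂ × (Sg k → ℂ) => ev (a + z.1 • b) z.2) =
      fun z i => eval z.2 (a i) + z.1 * eval z.2 (b i) := by
    funext z i
    simp only [ev, Pi.add_apply, Pi.smul_apply, map_add, smul_eval]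
  rw [this]
  refine contDiff_pi.2 fun i => ?_
  exact ((contDiff_eval (a i)).comp contDiff_snd).add
    (contDiff_fst.mul ((contDiff_eval (b i)).comp contDiff_snd))

theorem line_count (hN : N = ∑ j, k j) (a b : Fin N → MvPolynomial (Sg k) ℂ)
    (d : Fin N → Fin m → ℕ) (ha : ∀ i, MH (d i) (a i)) (hb : ∀ i, MH (d i) (b i))
    (U : Set (PX k)) (hU : IsOpen U) (W : Set ℂ) (hW : IsOpen W)
    (hseg : ∀ u : ℝ, 0 ≤ u → u ≤ 1 → (u : ℂ) ∈ W)
    (hbd : ∀ s ∈ W, Zs (a + s • b) ∩ closure U ⊆ U)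
    (h0 : Good (a + (0 : ℂ) • b)) (h1 : Good (a + (1 : ℂ) • b)) :
    (Zs (a + (0 : ℂ) • b) ∩ U).encard = (Zs (a + (1 : ℂ) • b) ∩ U).encard := by
  have hMH : ∀ t : ℂ, ∀ i, MH (d i) ((a + t • b) i) := fun t i => (ha i).add ((hb i).smul t)
  have hfin := good_line a b d ha hb 0 h0
  obtain ⟨S, hS, hSW, hSd, hS0, hS1⟩ := path_lemma _ hfin (fun h => h h0) (fun h => h h1) W hW hseg
  have hC := contDiff_line a b
  refine count_const (fun s : ℂ => Zs (a + s • b)) ?_ U hU S hS (fun s hs => hbd s (hSW hs)) ?_ 0 1 hS0 hS1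
  · exact closed_Zs (fun s : ℂ => a + s • b) d hMH hC.continuous
  · intro s hs P hP
    have hg : Good (a + s • b) := by
      by_contra hcon
      exact Set.disjoint_left.1 hSd hs hcon
    exact locnice hN (fun s : ℂ => a + s • b) d hMH hC s hg P hP.1

theorem good_count (hN : N = ∑ j, k j) (f : Fin N → MvPolynomial (Sg k) ℂ)
    (d : Fin N → Fin m → ℕ) (hf : ∀ i, MH (d i) (f i)) (hg : Good f) :
    (Zs f).encard = (Zs (start (k := k) d)).encard := by
  have hb : ∀ i, MH (d i) ((start (k := k) d + (-1 : ℂ) • f) i) := by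
    intro i
    have h1 := (MH_start (k := k) d i).add ((hf i).smul (-1))
    rw [Pi.add_apply, Pi.smul_apply]
    exact h1
  have h := line_count hN f (start d + (-1 : ℂ) • f) d hf hb Set.univ isOpen_univ Set.univ isOpen_univ
    (fun _ _ _ => trivial) (fun _ _ _ _ => trivial)
  have e0 : f + (0 : ℂ) • (start d + (-1 : ℂ) • f) = f := by simp
  have e1 : f + (1 : ℂ) • (start d + (-1 : ℂ) • f) = start d := by simp
  rw [e0, e1, Set.inter_univ, Set.inter_univ] at h
  exact h hg (start_good hN d)

lemma surj_pert (F h : Fin N → MvPolynomial (Sg k) ℂ) (p : Sg k → ℂ)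
    (hs : Function.Surjective (jac h p)) :
    ∀ᶠ e in nhdsWithin (0:ℂ) {0}ᶜ, Function.Surjective (jac (F + e • h) p) := by
  let JF : (Sg k → ℂ) →ₗ[ℂ] (Fin N → ℂ) := (jac F p : (Sg k → ℂ) →ₗ[ℂ] (Fin N → ℂ))
  let Jh : (Sg k → ℂ) →ₗ[ℂ] (Fin N → ℂ) := (jac h p : (Sg k → ℂ) →ₗ[ℂ] (Fin N → ℂ))
  obtain ⟨R, hR⟩ := Jh.exists_rightInverse_of_surjective (LinearMap.range_eq_top.2 hs)
  let A : Module.End ℂ (Fin N → ℂ) := JF.comp R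
  have hfin : {μ : ℂ | A.HasEigenvalue μ}.Finite := Module.End.finite_hasEigenvalue A
  apply eventually_of_finite (S := {e : ℂ | Function.Surjective (jac (F + e • h) p)})
  refine (hfin.image (fun x => -x)).subset ?_
  rintro e ⟨_, he⟩
  refine ⟨-e, ?_, by simp⟩
  rw [Set.mem_ofPred_eq]
  by_contra hno
  apply he
  let M : Module.End ℂ (Fin N → ℂ) := A - algebraMap ℂ _ (-e)
  have hinj : Function.Injective M := by
    rw [← LinearMap.ker_eq_bot]
    by_contra hne
    apply hno
    rw [Module.End.hasEigenvalue_iff, Module.End.eigenspace_def]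
    exact hne
  have hsur : Function.Surjective M := LinearMap.injective_iff_surjective.1 hinj
  intro y
  obtain ⟨v, hv⟩ := hsur y
  refine ⟨R v, ?_⟩
  rw [← hv]
  have hh : jac h p (R v) = v := LinearMap.congr_fun hR v
  funext i
  have hhi := congrFun hh i
  rw [jac_apply] at hhi
  rw [jac_apply, Pi.add_apply, Pi.smul_apply, dE_add, dE_smul, add_apply, smul_apply, hhi]
  simp only [M, LinearMap.sub_apply, Module.algebraMap_end_apply, Pi.sub_apply, Pi.smul_apply, smul_eq_mul]
  rw [neg_mul, sub_neg_eq_add]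
  rfl

/-- three-parameter family -/
noncomputable def fam (F A h G : Fin N → MvPolynomial (Sg k) ℂ) (z : ℂ × ℂ × ℂ) :
    Fin N → MvPolynomial (Sg k) ℂ := F + z.1 • A + z.2.1 • h + z.2.2 • G

lemma contDiff_fam (F A h G : Fin N → MvPolynomial (Sg k) ℂ) :
    ContDiff ℂ 1 (fun z : (ℂ × ℂ × ℂ) × (Sg k → ℂ) => ev (fam F A h G z.1) z.2) := by
  have : (fun z : (ℂ × ℂ × ℂ) × (Sg k → ℂ) => ev (fam F A h G z.1) z.2) =
      fun z i => eval z.2 (F i) + z.1.1 * eval z.2 (A i) + z.1.2.1 * eval z.2 (h i)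
        + z.1.2.2 * eval z.2 (G i) := by
    funext z i
    simp only [ev, fam, Pi.add_apply, Pi.smul_apply, map_add, smul_eval]
  rw [this]
  have c1 : ContDiff ℂ 1 (fun z : (ℂ × ℂ × ℂ) × (Sg k → ℂ) => z.1) := contDiff_fst
  have c2 : ContDiff ℂ 1 (fun z : (ℂ × ℂ × ℂ) × (Sg k → ℂ) => z.1.2) := contDiff_snd.comp c1
  refine contDiff_pi.2 fun i => ?_
  exact ((((contDiff_eval (F i)).comp contDiff_snd).add
    ((contDiff_fst.comp c1).mul ((contDiff_eval (A i)).comp contDiff_snd))).add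
    ((contDiff_fst.comp c2).mul ((contDiff_eval (h i)).comp contDiff_snd))).add
    ((contDiff_snd.comp c2).mul ((contDiff_eval (G i)).comp contDiff_snd))

theorem stab (hN : N = ∑ j, k j) (F A h G : Fin N → MvPolynomial (Sg k) ℂ)
    (e : Fin N → Fin m → ℕ) (hF : ∀ i, MH (e i) (F i)) (hA : ∀ i, MH (e i) (A i))
    (hh : ∀ i, MH (e i) (h i)) (hG : ∀ i, MH (e i) (G i)) (hGg : Good G)
    (p : XN k) (hFp : ev F p.1 = 0) (hhp : ev h p.1 = 0) (hhs : Function.Surjective (jac h p.1))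
    (U0 : Set (PX k)) (hU0 : IsOpen U0) (hPU : pr p ∈ U0)
    (hiso : ∀ Q ∈ U0, Q ∈ Zs F → Q = pr p) :
    ∀ᶠ t in nhds (0 : ℂ), ∃ Q ∈ U0, Q ∈ Zs (F + t • A) := by
  have hMH : ∀ z i, MH (e i) (fam F A h G z i) := fun z i =>
    (((hF i).add ((hA i).smul _)).add ((hh i).smul _)).add ((hG i).smul _)
  have hC := contDiff_fam F A h G
  have hcl : IsClosed {z : (ℂ × ℂ × ℂ) × PX k | z.2 ∈ Zs (fam F A h G z.1)} :=
    closed_Zs (fam F A h G) e hMH hC.continuous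
  have hcomp : ∀ (K : Set (PX k)) (z0 : ℂ × ℂ × ℂ), IsCompact K →
      (∀ y ∈ K, y ∉ Zs (fam F A h G z0)) → ∀ᶠ z in nhds z0, ∀ y ∈ K, y ∉ Zs (fam F A h G z) := by
    intro K z0 hK hy
    apply hK.eventually_forall_of_forall_eventually (P := fun z y => y ∉ Zs (fam F A h G z))
    intro y hyK
    exact hcl.isOpen_compl.mem_nhds (hy y hyK)
  obtain ⟨C, hCn, hCc, hCU⟩ := exists_mem_nhds_isClosed_subset (hU0.mem_nhds hPU)
  let U := interior C
  have hUo : IsOpen U := isOpen_interior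
  have hPU' : pr p ∈ U := mem_interior_iff_mem_nhds.2 hCn
  have hUc : closure U ⊆ U0 := (closure_minimal interior_subset hCc).trans hCU
  have hf0 : fam F A h G (0 : ℂ × ℂ × ℂ) = F := by simp [fam]
  have hK : ∀ᶠ z in nhds (0 : ℂ × ℂ × ℂ), ∀ y ∈ closure U \ U, y ∉ Zs (fam F A h G z) := by
    refine hcomp _ 0 (isClosed_closure.inter hUo.isClosed_compl).isCompact ?_
    intro y hy hyz
    rw [hf0] at hyz
    apply hy.2
    rw [hiso y (hUc hy.1) hyz]
    exact hPU'
  obtain ⟨δ, hδ, hball⟩ := Metric.eventually_nhds_iff_ball.1 hK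
  have hin : ∀ z ∈ Metric.ball (0 : ℂ × ℂ × ℂ) δ, Zs (fam F A h G z) ∩ closure U ⊆ U := by
    intro z hz y hy
    by_contra hyU
    exact hball z hz y ⟨hy.2, hyU⟩ hy.1
  have hbo : IsOpen (Metric.ball (0 : ℂ × ℂ × ℂ) δ) := Metric.isOpen_ball
  have hev0 : ∀ᶠ t in nhds (0 : ℂ), ((t, 0, 0) : ℂ × ℂ × ℂ) ∈ Metric.ball (0 : ℂ × ℂ × ℂ) δ := by
    have : Continuous (fun t : ℂ => ((t, 0, 0) : ℂ × ℂ × ℂ)) := by fun_prop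
    exact (hbo.preimage this).mem_nhds (by simpa using hδ)
  filter_upwards [hev0] with t ht
  by_contra hno
  push Not at hno
  -- first endpoint
  have hft : fam F A h G (t, 0, 0) = F + t • A := by simp [fam]
  have hE1 : ∀ᶠ s in nhdsWithin (0 : ℂ) {0}ᶜ, Good (fam F A h G (t, 0, s)) ∧
      ((t, 0, s) : ℂ × ℂ × ℂ) ∈ Metric.ball (0 : ℂ × ℂ × ℂ) δ ∧
      ∀ y ∈ closure U, y ∉ Zs (fam F A h G (t, 0, s)) := by
    have hcont : Continuous (fun s : ℂ => ((t, 0, s) : ℂ × ℂ × ℂ)) := by fun_prop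
    have g1 := good_pert' (F + t • A) G e (fun i => (hF i).add ((hA i).smul t)) hG hGg
    have g2 : ∀ᶠ s in nhds (0 : ℂ), ((t, 0, s) : ℂ × ℂ × ℂ) ∈ Metric.ball (0 : ℂ × ℂ × ℂ) δ :=
      (hbo.preimage hcont).mem_nhds ht
    have g3 : ∀ᶠ z in nhds ((t, 0, 0) : ℂ × ℂ × ℂ), ∀ y ∈ closure U, y ∉ Zs (fam F A h G z) := by
      refine hcomp _ _ isClosed_closure.isCompact ?_
      intro y hy
      rw [hft]
      exact hno y (hUc hy)
    have g3' : ∀ᶠ s in nhds (0 : ℂ), ∀ y ∈ closure U, y ∉ Zs (fam F A h G (t, 0, s)) :=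
      (hcont.tendsto 0).eventually g3
    filter_upwards [g1, g2.filter_mono nhdsWithin_le_nhds, g3'.filter_mono nhdsWithin_le_nhds]
      with s a1 a2 a3
    refine ⟨?_, a2, a3⟩
    have : fam F A h G (t, 0, s) = F + t • A + s • G := by simp [fam]
    rwa [this]
  have hnb := NormedField.nhdsNE_neBot (0 : ℂ)
  obtain ⟨s1, hs1g, hs1b, hs1z⟩ := hE1.exists
  -- second endpoint
  have hE2 : ∀ᶠ c in nhdsWithin (0 : ℂ) {0}ᶜ, Function.Surjective (jac (F + c • h) p.1) ∧
      ((0, c, 0) : ℂ × ℂ × ℂ) ∈ Metric.ball (0 : ℂ × ℂ × ℂ) δ := by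
    have hcont : Continuous (fun c : ℂ => ((0, c, 0) : ℂ × ℂ × ℂ)) := by fun_prop
    have g2 : ∀ᶠ c in nhds (0 : ℂ), ((0, c, 0) : ℂ × ℂ × ℂ) ∈ Metric.ball (0 : ℂ × ℂ × ℂ) δ :=
      (hbo.preimage hcont).mem_nhds (by simpa using hδ)
    exact (surj_pert F h p.1 hhs).and (g2.filter_mono nhdsWithin_le_nhds)
  obtain ⟨c, hcs, hcb⟩ := hE2.exists
  have hfc : fam F A h G (0, c, 0) = F + c • h := by simp [fam]
  have hE3 : ∀ᶠ s in nhdsWithin (0 : ℂ) {0}ᶜ, Good (fam F A h G (0, c, s)) ∧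
      ((0, c, s) : ℂ × ℂ × ℂ) ∈ Metric.ball (0 : ℂ × ℂ × ℂ) δ ∧
      ∃ Q ∈ U, Q ∈ Zs (fam F A h G (0, c, s)) := by
    have hcont : Continuous (fun s : ℂ => ((0, c, s) : ℂ × ℂ × ℂ)) := by fun_prop
    have g1 := good_pert' (F + c • h) G e (fun i => (hF i).add ((hh i).smul c)) hG hGg
    have g2 : ∀ᶠ s in nhds (0 : ℂ), ((0, c, s) : ℂ × ℂ × ℂ) ∈ Metric.ball (0 : ℂ × ℂ × ℂ) δ :=
      (hbo.preimage hcont).mem_nhds hcb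
    have hz : ev (fam F A h G (0, c, 0)) p.1 = 0 := by
      rw [hfc]
      funext i
      have q1 := congrFun hFp i
      have q2 := congrFun hhp i
      simp only [ev, Pi.zero_apply] at q1 q2
      simp only [ev, Pi.add_apply, Pi.smul_apply, map_add, smul_eval, q1, q2, mul_zero, add_zero,
        Pi.zero_apply]
    have g3 := loc_ex hN (fam F A h G) e hMH hC (0, c, 0) p hz (by rw [hfc]; exact hcs) U
      (hUo.mem_nhds hPU')
    have g3' : ∀ᶠ s in nhds (0 : ℂ), ∃ Q ∈ U, Q ∈ Zs (fam F A h G (0, c, s)) :=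
      (hcont.tendsto 0).eventually g3
    filter_upwards [g1, g2.filter_mono nhdsWithin_le_nhds, g3'.filter_mono nhdsWithin_le_nhds]
      with s a1 a2 a3
    refine ⟨?_, a2, a3⟩
    have : fam F A h G (0, c, s) = F + c • h + s • G := by simp [fam]
    rwa [this]
  obtain ⟨s2, hs2g, hs2b, Q, hQU, hQz⟩ := hE3.exists
  -- join
  let z1 : ℂ × ℂ × ℂ := (t, 0, s1)
  let z2 : ℂ × ℂ × ℂ := (0, c, s2)
  let b : Fin N → MvPolynomial (Sg k) ℂ := (-t) • A + c • h + (s2 - s1) • G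
  have hline : ∀ s : ℂ, fam F A h G z1 + s • b = fam F A h G (z1 + s • (z2 - z1)) := by
    intro s
    simp only [fam, z1, z2, b, Prod.fst_add, Prod.snd_add, Prod.smul_fst, Prod.smul_snd,
      Prod.fst_sub, Prod.snd_sub, smul_eq_mul, Prod.mk_sub_mk, Prod.smul_mk]
    module
  have hWo : IsOpen ((fun s : ℂ => z1 + s • (z2 - z1)) ⁻¹' Metric.ball (0 : ℂ × ℂ × ℂ) δ) :=
    hbo.preimage (by fun_prop)
  have e0 : fam F A h G z1 + (0 : ℂ) • b = fam F A h G z1 := by rw [hline]; simp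
  have e1 : fam F A h G z1 + (1 : ℂ) • b = fam F A h G z2 := by rw [hline]; simp
  have key := line_count hN (fam F A h G z1) b e (hMH z1)
    (fun i => (((hA i).smul _).add ((hh i).smul _)).add ((hG i).smul _)) U hUo _ hWo
    (by
      intro u hu0 hu1
      have hconv := convex_ball (0 : ℂ × ℂ × ℂ) δ
      have := hconv.add_smul_sub_mem hs1b hs2b ⟨hu0, hu1⟩
      rw [Set.mem_preimage]
      convert this using 2
      exact Complex.coe_smul u _)
    (by
      intro s hs
      rw [hline s]
      exact hin _ hs)
    (by rw [e0]; exact hs1g) (by rw [e1]; exact hs2g)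
  rw [e0, e1] at key
  have k0 : Zs (fam F A h G z1) ∩ U = ∅ := by
    ext y
    simp only [Set.mem_inter_iff, Set.mem_empty_iff_false, iff_false, not_and]
    intro hy hyU
    exact hs1z y (subset_closure hyU) hy
  rw [k0, Set.encard_empty] at key
  have := Set.encard_eq_zero.1 key.symm
  have hmem : Q ∈ Zs (fam F A h G z2) ∩ U := ⟨hQz, hQU⟩
  rw [this] at hmem
  exact hmem

end MB

namespace MB
variable {m N : ℕ} {k : Fin m → ℕ}

/-- monomial in the pivot variables -/
noncomputable def piv (r : ∀ j, Fin (k j + 1)) (u : Fin m → ℕ) : MvPolynomial (Sg k) ℂ :=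
  ∏ j, X (⟨j, r j⟩ : Sg k) ^ u j

lemma MH_piv (r : ∀ j, Fin (k j + 1)) (u : Fin m → ℕ) : MH u (piv (k := k) r u) := by
  have h := MH.prod (k := k) Finset.univ (fun j => u j • Pi.single j 1)
    (fun j => X (⟨j, r j⟩ : Sg k) ^ u j) (fun j _ => (MH_X (⟨j, r j⟩ : Sg k)).pow (u j))
  have e : ∑ j, u j • (Pi.single j 1 : Fin m → ℕ) = u := by
    funext j
    rw [Finset.sum_apply, Finset.sum_eq_single j]
    · simp
    · intro b _ hb; simp [hb.symm]
    · simp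
  rw [e] at h
  exact h

lemma eval_piv (r : ∀ j, Fin (k j + 1)) (u : Fin m → ℕ) (x : Sg k → ℂ)
    (hx : ∀ j, x ⟨j, r j⟩ ≠ 0) : eval x (piv (k := k) r u) ≠ 0 := by
  rw [piv, map_prod]
  refine Finset.prod_ne_zero_iff.2 fun j _ => ?_
  rw [map_pow, eval_X]
  exact pow_ne_zero _ (hx j)

/-- 2x2 minor -/
noncomputable def mnr (p : Sg k → ℂ) (j : Fin m) (a b : Fin (k j + 1)) : MvPolynomial (Sg k) ℂ :=
  p ⟨j, a⟩ • X ⟨j, b⟩ + (-p ⟨j, b⟩) • X ⟨j, a⟩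

lemma MH_mnr (p : Sg k → ℂ) (j : Fin m) (a b : Fin (k j + 1)) :
    MH (Pi.single j 1) (mnr p j a b) :=
  ((MH_X (⟨j, b⟩ : Sg k)).smul _).add ((MH_X (⟨j, a⟩ : Sg k)).smul _)

lemma exists_h (hN : N = ∑ j, k j) (e : Fin N → Fin m → ℕ) (he : ∀ i j, 1 ≤ e i j) (p : Sg k → ℂ)
    (r : ∀ j, Fin (k j + 1)) (hr : ∀ j, p ⟨j, r j⟩ ≠ 0) :
    ∃ h : Fin N → MvPolynomial (Sg k) ℂ, (∀ i, MH (e i) (h i)) ∧ ev h p = 0 ∧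
      Function.Surjective (jac h p) := by
  have hcard : Fintype.card (Fin N) = Fintype.card (Σ j, Fin (k j)) := by
    simp [hN]
  let σ : Fin N ≃ (Σ j, Fin (k j)) := Fintype.equivOfCardEq hcard
  let mn : Fin N → MvPolynomial (Sg k) ℂ := fun i =>
    mnr p (σ i).1 (r (σ i).1) ((r (σ i).1).succAbove (σ i).2)
  let M : Fin N → MvPolynomial (Sg k) ℂ := fun i => piv r (e i - Pi.single (σ i).1 1)
  have hM : ∀ i, eval p (M i) ≠ 0 := fun i => eval_piv r _ p hr
  have hmn : ∀ i, eval p (mn i) = 0 := by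
    intro i
    simp only [mn, mnr, map_add, smul_eval, eval_X]
    ring
  refine ⟨fun i => mn i * M i, ?_, ?_, ?_⟩
  · intro i
    have h1 := (MH_mnr p (σ i).1 (r (σ i).1) ((r (σ i).1).succAbove (σ i).2)).mul
      (MH_piv (k := k) r (e i - Pi.single (σ i).1 1))
    have h2 : Pi.single (σ i).1 1 + (e i - Pi.single (σ i).1 1) = e i := by
      funext j
      simp only [Pi.add_apply, Pi.sub_apply]
      by_cases hj : j = (σ i).1
      · subst hj
        have := he i (σ i).1
        simp only [Pi.single_eq_same]
        omega
      · simp [hj]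
    rw [h2] at h1
    exact h1
  · funext i
    simp only [ev, map_mul, hmn, zero_mul, Pi.zero_apply]
  · intro y
    let v : Sg k → ℂ := fun q =>
      (r q.1).insertNth (α := fun _ => ℂ) 0 (fun s => (eval p (M (σ.symm ⟨q.1, s⟩)) * p ⟨q.1, r q.1⟩)⁻¹ *
        y (σ.symm ⟨q.1, s⟩)) q.2
    refine ⟨v, ?_⟩
    funext i
    rw [jac_apply, dE_mul, hmn, add_apply, smul_apply, smul_apply, zero_smul, zero_add, smul_eq_mul]
    simp only [mn, mnr]
    rw [dE_add, dE_smul, dE_smul, dE_X, dE_X, add_apply, smul_apply, smul_apply,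
      ContinuousLinearMap.proj_apply, ContinuousLinearMap.proj_apply]
    have v1 : v ⟨(σ i).1, r (σ i).1⟩ = 0 := by
      simp only [v, Fin.insertNth_apply_same]
    have v2 : v ⟨(σ i).1, (r (σ i).1).succAbove (σ i).2⟩ =
        (eval p (M i) * p ⟨(σ i).1, r (σ i).1⟩)⁻¹ * y i := by
      simp only [v, Fin.insertNth_apply_succAbove, Sigma.eta, Equiv.symm_apply_apply]
    rw [v1, v2, smul_zero, add_zero, smul_eq_mul, ← mul_assoc, ← mul_assoc,
      mul_inv_cancel₀ (mul_ne_zero (hM i) (hr _)), one_mul]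

theorem persist (hN : N = ∑ j, k j) (f g : Fin N → MvPolynomial (Sg k) ℂ)
    (d : Fin N → Fin m → ℕ) (hf : ∀ i, MH (d i) (f i)) (hg : ∀ i, MH (d i) (g i))
    (P : PX k) (hP : P ∈ Zs f) (U1 : Set (PX k)) (hU1 : U1 ∈ nhds P) (hiso : U1 ∩ Zs f = {P})
    (U : Set (PX k)) (hU : U ∈ nhds P) :
    ∀ᶠ t in nhds (0 : ℂ), ∃ Q ∈ U, Q ∈ Zs (f + t • g) := by
  obtain ⟨p, rfl⟩ := oqm_pr.surjective P
  rw [mem_Zs hf] at hP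
  choose r hr using p.2
  let O : Set (PX k) := pr '' {x : XN k | ∀ j, x.1 ⟨j, r j⟩ ≠ 0}
  have hO : IsOpen O := by
    refine oqm_pr.isOpenMap _ ?_
    have : {x : XN k | ∀ j, x.1 ⟨j, r j⟩ ≠ 0} = ⋂ j, {x : XN k | x.1 ⟨j, r j⟩ ≠ 0} := by
      ext x; simp
    rw [this]
    refine isOpen_iInter_of_finite fun j => ?_
    exact isOpen_ne_fun ((continuous_apply _).comp continuous_subtype_val) continuous_const
  let l : MvPolynomial (Sg k) ℂ := piv r 1
  have hml : ∀ u : Fin N → MvPolynomial (Sg k) ℂ, (∀ i, MH (d i) (u i)) →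
      ∀ i, MH (d i + 1) (u i * l) := fun u hu i => (hu i).mul (MH_piv r 1)
  have hiff : ∀ u : Fin N → MvPolynomial (Sg k) ℂ, (∀ i, MH (d i) (u i)) → ∀ Q ∈ O,
      (Q ∈ Zs (fun i => u i * l) ↔ Q ∈ Zs u) := by
    rintro u hu _ ⟨x, hx, rfl⟩
    rw [mem_Zs (hml u hu), mem_Zs hu, funext_iff, funext_iff]
    refine forall_congr' fun i => ?_
    simp only [ev, map_mul, Pi.zero_apply, mul_eq_zero]
    exact or_iff_left (eval_piv r 1 x.1 hx)
  obtain ⟨h, hh, hh0, hhs⟩ := exists_h hN (fun i => d i + 1) (fun i j => by simp) p.1 r hr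
  have hstab := stab hN (fun i => f i * l) (fun i => g i * l) h (start fun i => d i + 1)
    (fun i => d i + 1) (hml f hf) (hml g hg) hh (MH_start _) (start_good hN _) p
    (by
      funext i
      have := congrFun hP i
      simp only [ev, Pi.zero_apply] at this
      simp only [ev, map_mul, Pi.zero_apply, this, zero_mul]) hh0 hhs
    (interior U1 ∩ interior U ∩ O) ((isOpen_interior.inter isOpen_interior).inter hO)
    ⟨⟨mem_interior_iff_mem_nhds.2 hU1, mem_interior_iff_mem_nhds.2 hU⟩, ⟨p, hr, rfl⟩⟩
    (by
      intro Q hQ hz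
      rw [hiff f hf Q hQ.2] at hz
      have : Q ∈ U1 ∩ Zs f := ⟨interior_subset hQ.1.1, hz⟩
      rw [hiso] at this
      exact this)
  filter_upwards [hstab] with t ht
  obtain ⟨Q, hQ, hz⟩ := ht
  refine ⟨Q, interior_subset hQ.1.2, ?_⟩
  have hft : ∀ i, MH (d i) ((f + t • g) i) := fun i => (hf i).add ((hg i).smul t)
  rw [← hiff (f + t • g) hft Q hQ.2]
  have e : (fun i => (f + t • g) i * l) = (fun i => f i * l) + t • (fun i => g i * l) := by
    funext i
    simp only [Pi.add_apply, Pi.smul_apply, add_mul, smul_mul_assoc]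
  rw [e]
  exact hz

theorem iso_bound (hN : N = ∑ j, k j) (f : Fin N → MvPolynomial (Sg k) ℂ)
    (d : Fin N → Fin m → ℕ) (hf : ∀ i, MH (d i) (f i)) (B : ℕ)
    (hB : (Zs (start (k := k) d)).encard = B) :
    Set.encard {P ∈ Zs f | ∃ U ∈ nhds P, U ∩ Zs f = {P}} ≤ (B : ℕ∞) := by
  by_contra hcon
  rw [not_le] at hcon
  have h1 : ((B + 1 : ℕ) : ℕ∞) ≤ Set.encard {P ∈ Zs f | ∃ U ∈ nhds P, U ∩ Zs f = {P}} := by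
    push_cast
    exact Order.add_one_le_of_lt hcon
  obtain ⟨S, hS, hSc⟩ := Set.exists_subset_encard_eq h1
  have hSf : S.Finite := Set.finite_of_encard_eq_coe hSc
  obtain ⟨O, hO, hOd⟩ := hSf.t2_separation
  have hev : ∀ᶠ t in nhds (0 : ℂ), ∀ P ∈ S, ∃ Q ∈ O P, Q ∈ Zs (f + t • start d) := by
    rw [Filter.eventually_all_finite hSf]
    intro P hP
    obtain ⟨hPz, U1, hU1, hiso⟩ := hS hP
    exact persist hN f (start d) d hf (MH_start d) P hPz U1 hU1 hiso (O P) ((hO P).2.mem_nhds (hO P).1)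
  have hgood := good_pert' f (start d) d hf (MH_start d) (start_good hN d)
  have hnb := NormedField.nhdsNE_neBot (0 : ℂ)
  obtain ⟨t, ht, hg⟩ := ((hev.filter_mono nhdsWithin_le_nhds).and hgood).exists
  have hMH : ∀ i, MH (d i) ((f + t • (start d : Fin N → MvPolynomial (Sg k) ℂ)) i) := by
    intro i
    have := (hf i).add ((MH_start (k := k) d i).smul t)
    rw [Pi.add_apply, Pi.smul_apply]
    exact this
  have hcount := good_count hN (f + t • start d) d hMH hg
  choose! φ hφ hφz using ht
  have hinj : Set.InjOn φ S := by
    intro a ha b hb hab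
    by_contra hne
    exact Set.disjoint_left.1 (hOd ha hb hne) (hφ a ha) (hab ▸ hφ b hb)
  have hle : S.encard ≤ (Zs (f + t • start d)).encard := by
    rw [← hinj.encard_image]
    apply Set.encard_le_encard
    rintro _ ⟨a, ha, rfl⟩
    exact hφz a ha
  rw [hcount, hB, hSc] at hle
  have := Nat.cast_le.1 hle
  omega

theorem main_aux (hN : N = ∑ j, k j) (f : Fin N → MvPolynomial (Sg k) ℂ)
    (d : Fin N → Fin m → ℕ) (hf : ∀ i, MH (d i) (f i)) (B : ℕ)
    (hB : (B : ℕ) = coeff (Finsupp.equivFunOnFinite.symm k)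
      (∏ i : Fin N, ∑ j : Fin m, (C (d i j) * X j : MvPolynomial (Fin m) ℕ))) :
    Set.encard {P ∈ Zs f | ∃ U ∈ nhds P, U ∩ Zs f = {P}} ≤ (B : ℕ∞) ∧
    ((∀ P ∈ Zs f, Function.Surjective (fderiv ℂ (ev f) (rp P).1)) → (Zs f).encard = B) := by
  have hcard : (Zs (start (k := k) d)).encard = B := by
    rw [start_card hN, bez_card, hB]
  refine ⟨iso_bound hN f d hf B hcard, fun hs => ?_⟩
  rw [← hcard]
  refine good_count hN f d hf ?_
  intro x hx h0
  have hz := (mem_Zs hf ⟨x, hx⟩).2 h0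
  have h1 := hs _ hz
  rw [(hasFDerivAt_ev f _).fderiv] at h1
  obtain ⟨lam, hl, he⟩ := (pr_eq_iff _ _).1 (pr_rp (pr ⟨x, hx⟩)).symm
  have h2 := surj_scl hf lam hl _ h1
  rw [← he] at h2
  exact h2

end MB

/-- **Multi-homogeneous Bézout theorem.**
Variables are partitioned into `m` groups, the `j`-th with `k j + 1` variables
(indexed by `Σ j, Fin (k j + 1)`), and `f` is a system of `N = ∑ k j`
multi-homogeneous polynomials with multidegrees `d i j`. The Bézout number `B`
is the coefficient of `∏ ζ_j ^ k j` in `∏_i ∑_j d i j · ζ_j`. The number of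
isolated zeros of `f` in `ℙ^{k 0}(ℂ) × ⋯ × ℙ^{k (m-1)}(ℂ)` is at most `B`, and
if all zeros are nonsingular then the number of zeros is exactly `B`. -/
theorem multihomogeneous_bezout
    (m : ℕ) (k : Fin m → ℕ) (N : ℕ) (hN : N = ∑ j, k j)
    (f : Fin N → MvPolynomial (Σ j : Fin m, Fin (k j + 1)) ℂ)
    (d : Fin N → Fin m → ℕ)
    (hmh : ∀ (i : Fin N) (j : Fin m) (lam : ℂ) (p : (Σ j' : Fin m, Fin (k j' + 1)) → ℂ),
      eval (fun q => if q.1 = j then lam * p q else p q) (f i)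
        = lam ^ (d i j) * eval p (f i))
    (B : ℕ)
    (hB : (B : ℕ) = coeff (Finsupp.equivFunOnFinite.symm k)
      (∏ i : Fin N, ∑ j : Fin m, (C (d i j) * X j : MvPolynomial (Fin m) ℕ)))
    (Z : Set (∀ j : Fin m, Projectivization ℂ (Fin (k j + 1) → ℂ)))
    (hZ : Z = {P | ∀ i : Fin N, eval (fun q => (P q.1).rep q.2) (f i) = 0}) :
    Set.encard {P ∈ Z | ∃ U ∈ nhds P, U ∩ Z = {P}} ≤ (B : ℕ∞)
    ∧ ((∀ P ∈ Z, Function.Surjective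
          (fderiv ℂ (fun p : (Σ j : Fin m, Fin (k j + 1)) → ℂ =>
            (fun i : Fin N => eval p (f i)))
            (fun q => (P q.1).rep q.2))) →
        Set.encard Z = (B : ℕ∞)) := by
  have hf : ∀ i, MB.MH (d i) (f i) := fun i => MB.MH_of_single (f i) (d i) (hmh i)
  have hZ' : Z = MB.Zs f := by
    rw [hZ]
    ext P
    exact funext_iff.symm
  subst hZ'
  exact MB.main_aux hN f d hf B hB
end

section
/- Let m > n ≥ 1. For Lebesgue-almost every pair (A, b) with A a real m×n matrix and b ∈ ℝ^m, the number of sign vectors ε ∈ {−1,1}^m for which the set {x ∈ ℝ^n : ε_i((Ax)_i − b_i) > 0 for all i = 1,…,m} is nonempty and bounded is exactly the binomial coefficient C(m−1, n). -/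
open MeasureTheory

theorem ae_det_ne {P : Type*} [NormedAddCommGroup P] [NormedSpace ℝ P] [FiniteDimensional ℝ P]
    [MeasurableSpace P] [BorelSpace P] (μ : Measure P) [μ.IsAddHaarMeasure]
    {κ : Type*} [Fintype κ] [DecidableEq κ] (M : P →ₗ[ℝ] Matrix κ κ ℝ) (y : P)
    (hy : (M y).det ≠ 0) : ∀ᵐ p ∂μ, (M p).det ≠ 0 := by
  have hcont : Continuous fun p => (M p).det :=
    (LinearMap.continuous_of_finiteDimensional M).matrix_det
  refine ae_mem_of_ae_add_linearMap_mem (s := {p | (M p).det ≠ 0})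
    (LinearMap.toSpanSingleton ℝ P y) volume μ ?_ ?_
  · exact (isOpen_ne_fun hcont continuous_const).measurableSet
  · intro x
    set N := -((M y)⁻¹ * M x)
    have key : ∀ t : ℝ, (M (x + t • y)).det = (M y).det * N.charpoly.eval t := by
      intro t
      rw [Matrix.eval_charpoly, ← Matrix.det_mul, mul_sub, map_add, map_smul]
      simp only [N, mul_neg, sub_neg_eq_add]
      rw [← mul_assoc, Matrix.mul_nonsing_inv _ (isUnit_iff_ne_zero.mpr hy), one_mul, add_comm]
      congr 2
      ext i j
      simp [mul_comm]
    have hfin : {t : ℝ | ¬ (x + (LinearMap.toSpanSingleton ℝ P y) t ∈ {p | (M p).det ≠ 0})}.Finite := by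
      refine (N.charpoly.roots.toFinset.finite_toSet).subset ?_
      intro t ht
      simp only [LinearMap.toSpanSingleton_apply, Set.mem_ofPred_eq, not_not, key, mul_eq_zero, hy,
        false_or] at ht
      simp [Polynomial.IsRoot, ht, (Matrix.charpoly_monic N).ne_zero]
    exact hfin.measure_zero _

theorem haar_inst (m n : ℕ) :
    (volume : Measure ((Fin m → Fin n → ℝ) × (Fin m → ℝ))).IsAddHaarMeasure := by
  have h1 : (volume : Measure (Fin m → Fin n → ℝ)).IsAddHaarMeasure :=
    Measure.pi.isAddHaarMeasure (fun _ : Fin m => (volume : Measure (Fin n → ℝ)))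
  exact Measure.prod.instIsAddHaarMeasure (volume : Measure (Fin m → Fin n → ℝ))
    (volume : Measure (Fin m → ℝ))

theorem gen1 (m n : ℕ) (e : Fin n → Fin m) (he : Function.Injective e) :
    ∀ᵐ p ∂(volume : Measure ((Fin m → Fin n → ℝ) × (Fin m → ℝ))),
      (Matrix.of fun i j => p.1 (e i) j : Matrix (Fin n) (Fin n) ℝ).det ≠ 0 := by
  let M : ((Fin m → Fin n → ℝ) × (Fin m → ℝ)) →ₗ[ℝ] Matrix (Fin n) (Fin n) ℝ :=
    { toFun := fun p => Matrix.of fun i j => p.1 (e i) j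
      map_add' := fun p q => rfl
      map_smul' := fun c p => rfl }
  have := haar_inst m n
  refine ae_det_ne volume M (fun i j => if i = e j then 1 else 0, 0) ?_
  have : M (fun i j => if i = e j then 1 else 0, 0) = 1 := by
    ext i j
    change (if e i = e j then (1 : ℝ) else 0) = _
    simp [Matrix.one_apply, he.eq_iff]
  rw [this]; simp

theorem gen2 (m n : ℕ) (e : Option (Fin n) → Fin m) (he : Function.Injective e) :
    ∀ᵐ p ∂(volume : Measure ((Fin m → Fin n → ℝ) × (Fin m → ℝ))),
      (Matrix.of fun i j => j.elim (p.2 (e i)) (p.1 (e i)) :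
        Matrix (Option (Fin n)) (Option (Fin n)) ℝ).det ≠ 0 := by
  let M : ((Fin m → Fin n → ℝ) × (Fin m → ℝ)) →ₗ[ℝ]
      Matrix (Option (Fin n)) (Option (Fin n)) ℝ :=
    { toFun := fun p => Matrix.of fun i j => j.elim (p.2 (e i)) (p.1 (e i))
      map_add' := fun p q => by ext i j; cases j <;> rfl
      map_smul' := fun c p => by ext i j; cases j <;> rfl }
  have := haar_inst m n
  refine ae_det_ne volume M (fun i j => if i = e (some j) then 1 else 0,
    fun i => if i = e none then 1 else 0) ?_
  have : M (fun i j => if i = e (some j) then 1 else 0,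
    fun i => if i = e none then 1 else 0) = 1 := by
    ext i j
    cases j <;> simp [M, Matrix.one_apply, he.eq_iff]
  rw [this]; simp

theorem gen (m n : ℕ) :
    ∀ᵐ p ∂(volume : Measure ((Fin m → Fin n → ℝ) × (Fin m → ℝ))),
      (∀ s : Finset (Fin m), s.card = n → ∀ r : Fin m → ℝ, ∃ d, ∀ i ∈ s, p.1 i ⬝ᵥ d = r i) ∧
      (∀ s : Finset (Fin m), s.card = n → ∀ d, (∀ i ∈ s, p.1 i ⬝ᵥ d = 0) → d = 0) ∧
      (∀ s : Finset (Fin m), s.card = n + 1 → ∀ d, ¬ (∀ i ∈ s, p.1 i ⬝ᵥ d = p.2 i)) := by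
  have h1 : ∀ᵐ p ∂(volume : Measure ((Fin m → Fin n → ℝ) × (Fin m → ℝ))),
     ∀ e : Fin n → Fin m, Function.Injective e →
      (Matrix.of fun i j => p.1 (e i) j : Matrix (Fin n) (Fin n) ℝ).det ≠ 0 := by
    rw [ae_all_iff]; intro e
    by_cases he : Function.Injective e
    · filter_upwards [gen1 m n e he] with p hp _ using hp
    · exact Filter.Eventually.of_forall fun p h => absurd h he
  have h2 : ∀ᵐ p ∂(volume : Measure ((Fin m → Fin n → ℝ) × (Fin m → ℝ))),
     ∀ e : Option (Fin n) → Fin m, Function.Injective e →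
      (Matrix.of fun i j => j.elim (p.2 (e i)) (p.1 (e i)) :
        Matrix (Option (Fin n)) (Option (Fin n)) ℝ).det ≠ 0 := by
    rw [ae_all_iff]; intro e
    by_cases he : Function.Injective e
    · filter_upwards [gen2 m n e he] with p hp _ using hp
    · exact Filter.Eventually.of_forall fun p h => absurd h he
  filter_upwards [h1, h2] with p g1 g2
  refine ⟨?_, ?_, ?_⟩
  · intro s hs r
    let e := s.equivFinOfCardEq hs
    have hd := g1 (fun i => (e.symm i : Fin m)) (Subtype.val_injective.comp e.symm.injective)
    set Q : Matrix (Fin n) (Fin n) ℝ := Matrix.of fun i j => p.1 (e.symm i) j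
    refine ⟨Q⁻¹.mulVec (fun i => r (e.symm i)), ?_⟩
    intro i hi
    have h : Q.mulVec (Q⁻¹.mulVec (fun i => r (e.symm i))) = fun i => r (e.symm i) := by
      rw [Matrix.mulVec_mulVec, Matrix.mul_nonsing_inv _ (isUnit_iff_ne_zero.mpr hd),
        Matrix.one_mulVec]
    have := congrFun h (e ⟨i, hi⟩)
    simpa [Matrix.mulVec, Q] using this
  · intro s hs d hd0
    let e := s.equivFinOfCardEq hs
    have hd := g1 (fun i => (e.symm i : Fin m)) (Subtype.val_injective.comp e.symm.injective)
    refine Matrix.eq_zero_of_mulVec_eq_zero hd ?_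
    ext i
    exact hd0 _ (e.symm i).2
  · intro s hs d h
    let e : s ≃ Option (Fin n) := Fintype.equivOfCardEq (by simp [hs])
    have hd := g2 (fun i => (e.symm i : Fin m)) (Subtype.val_injective.comp e.symm.injective)
    have := Matrix.eq_zero_of_mulVec_eq_zero (v := fun j => j.elim (-1) d) hd (by
      ext i
      have := h _ (e.symm i).2
      simp only [dotProduct] at this
      simp [Matrix.mulVec, dotProduct, Fintype.sum_option, this])
    simpa using congrFun this none


noncomputable def sg (c : Bool) : ℝ := if c then 1 else -1

theorem sg_sq (c : Bool) : sg c * sg c = 1 := by cases c <;> simp [sg]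
theorem sg_abs (c : Bool) : |sg c| = 1 := by cases c <;> simp [sg]
theorem sg_dec (x : ℝ) (hx : x ≠ 0) : 0 < sg (decide (0 < x)) * x := by
  rcases lt_or_gt_of_ne hx with h | h
  · simp [sg, h, not_lt.mpr h.le]
  · simp [sg, h]
theorem sg_uniq {c c' : Bool} {x : ℝ} (h : 0 < sg c * x) (h' : 0 < sg c' * x) : c = c' := by
  cases c <;> cases c' <;> simp [sg] at * <;> linarith

section
variable {m n : ℕ}

def Ex (a : Fin m → Fin n → ℝ) : Prop :=
  ∀ s : Finset (Fin m), s.card = n → ∀ r : Fin m → ℝ, ∃ d, ∀ i ∈ s, a i ⬝ᵥ d = r i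
def Uq (a : Fin m → Fin n → ℝ) : Prop :=
  ∀ s : Finset (Fin m), s.card = n → ∀ d, (∀ i ∈ s, a i ⬝ᵥ d = 0) → d = 0
def Gn (a : Fin m → Fin n → ℝ) (b : Fin m → ℝ) : Prop :=
  ∀ s : Finset (Fin m), s.card = n + 1 → ∀ d, ¬ (∀ i ∈ s, a i ⬝ᵥ d = b i)

def C3 (a : Fin m → Fin n → ℝ) (k : Fin m) (S : Finset (Fin m)) (σ : Fin m → Bool) : Prop :=
  ∀ i ∈ S, ∀ d, (∀ j ∈ S, j ≠ i → a j ⬝ᵥ d = 0) → 0 < sg (σ i) * (a i ⬝ᵥ d) →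
    sg (σ k) * (a k ⬝ᵥ d) < 0

def BRel (a : Fin m → Fin n → ℝ) (b : Fin m → ℝ) (k : Fin m) (S : Finset (Fin m))
    (σ : Fin m → Bool) : Prop :=
  ∃ v, (∀ i ∈ S, a i ⬝ᵥ v = b i) ∧ (∀ i ∉ S, 0 < sg (σ i) * (a i ⬝ᵥ v - b i)) ∧ C3 a k S σ

def Cell (a : Fin m → Fin n → ℝ) (b : Fin m → ℝ) (σ : Fin m → Bool) : Set (Fin n → ℝ) :=
  {x | ∀ i, 0 < sg (σ i) * (a i ⬝ᵥ x - b i)}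

theorem dual {a : Fin m → Fin n → ℝ} (hE : Ex a) (hU : Uq a) {S : Finset (Fin m)}
    (hS : S.card = n) : ∃ D : Fin m → Fin n → ℝ,
      (∀ i ∈ S, ∀ j ∈ S, a j ⬝ᵥ D i = if j = i then 1 else 0) ∧
      ∀ x, x = ∑ i ∈ S, (a i ⬝ᵥ x) • D i := by
  choose D hD using fun i : Fin m => hE S hS (fun j => if j = i then 1 else 0)
  refine ⟨D, fun i _ j hj => hD i j hj, fun x => ?_⟩
  rw [← sub_eq_zero]
  refine hU S hS _ fun j hj => ?_
  rw [dotProduct_sub, dotProduct_sum, sub_eq_zero]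
  simp only [dotProduct_smul, smul_eq_mul]
  rw [Finset.sum_congr rfl (fun i _ => by rw [hD i j hj])]
  simp [hj]

theorem weights {a : Fin m → Fin n → ℝ} (hE : Ex a) (hU : Uq a) {S : Finset (Fin m)}
    (hS : S.card = n) {k : Fin m} {σ : Fin m → Bool} (h3 : C3 a k S σ) :
    ∃ (D : Fin m → Fin n → ℝ) (μ : Fin m → ℝ), (∀ i ∈ S, 0 < μ i) ∧
      (∀ x, x = ∑ i ∈ S, (a i ⬝ᵥ x) • D i) ∧
      ∀ x, sg (σ k) * (a k ⬝ᵥ x) = - ∑ i ∈ S, μ i * (sg (σ i) * (a i ⬝ᵥ x)) := by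
  obtain ⟨D, hD, hx⟩ := dual hE hU hS
  refine ⟨D, fun i => -(sg (σ k) * sg (σ i) * (a k ⬝ᵥ D i)), ?_, hx, ?_⟩
  · intro i hi
    have := h3 i hi (sg (σ i) • D i) ?_ ?_
    · rw [dotProduct_smul, smul_eq_mul] at this
      simp only
      linarith
    · intro j hj hji
      simp [dotProduct_smul, hD i hi j hj, hji]
    · simp [dotProduct_smul, hD i hi i hi, sg_sq]
  · intro x
    conv_lhs => rw [hx x]
    rw [dotProduct_sum, Finset.mul_sum, ← Finset.sum_neg_distrib]
    refine Finset.sum_congr rfl fun i _ => ?_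
    rw [dotProduct_smul, smul_eq_mul]
    linear_combination (-(sg (σ k) * (a k ⬝ᵥ D i) * (a i ⬝ᵥ x))) * sg_sq (σ i)

theorem rel_bdd {a : Fin m → Fin n → ℝ} {b : Fin m → ℝ} (hE : Ex a) (hU : Uq a)
    {S : Finset (Fin m)} (hS : S.card = n) {k : Fin m} {σ : Fin m → Bool}
    (h : BRel a b k S σ) : Bornology.IsBounded (Cell a b σ) := by
  obtain ⟨v, hv, _, h3⟩ := h
  obtain ⟨D, μ, hμ, hx, hk⟩ := weights hE hU hS h3
  rw [isBounded_iff_forall_norm_le]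
  set C := sg (σ k) * (a k ⬝ᵥ v - b k) with hC
  refine ⟨‖v‖ + ∑ i ∈ S, C / μ i * ‖D i‖, fun x hxc => ?_⟩
  have hw : ∀ i ∈ S, 0 < sg (σ i) * (a i ⬝ᵥ (x - v)) := by
    intro i hi
    rw [dotProduct_sub, hv i hi]
    exact hxc i
  have hsum : ∑ i ∈ S, μ i * (sg (σ i) * (a i ⬝ᵥ (x - v))) < C := by
    have h1 := hk (x - v)
    have h2 := hxc k
    have h4 : sg (σ k) * (a k ⬝ᵥ (x - v)) = sg (σ k) * (a k ⬝ᵥ x - b k) - C := by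
      rw [dotProduct_sub, hC]; ring
    linarith
  have hle : ∀ i ∈ S, |a i ⬝ᵥ (x - v)| ≤ C / μ i := by
    intro i hi
    rw [le_div_iff₀ (hμ i hi)]
    have h1 := Finset.single_le_sum (f := fun i => μ i * (sg (σ i) * (a i ⬝ᵥ (x - v))))
      (fun j hj => (mul_pos (hμ j hj) (hw j hj)).le) hi
    have h2 : |a i ⬝ᵥ (x - v)| = sg (σ i) * (a i ⬝ᵥ (x - v)) := by
      rw [← abs_of_pos (hw i hi), abs_mul, sg_abs, one_mul]
    rw [h2]
    linarith
  calc ‖x‖ = ‖v + (x - v)‖ := by congr 1; abel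
    _ ≤ ‖v‖ + ‖x - v‖ := norm_add_le _ _
    _ ≤ _ := by
      gcongr
      conv_lhs => rw [hx (x - v)]
      refine (norm_sum_le _ _).trans (Finset.sum_le_sum fun i hi => ?_)
      rw [norm_smul, Real.norm_eq_abs]
      gcongr
      exact hle i hi

theorem rel_inj {a : Fin m → Fin n → ℝ} {b : Fin m → ℝ} (hE : Ex a) (hU : Uq a)
    {S S' : Finset (Fin m)} (hS : S.card = n) (hS' : S'.card = n) {k : Fin m}
    {σ : Fin m → Bool} (h : BRel a b k S σ) (h' : BRel a b k S' σ) : S = S' := by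
  obtain ⟨v, hv, hp, h3⟩ := h
  obtain ⟨v', hv', hp', h3'⟩ := h'
  obtain ⟨D, μ, hμ, hx, hk⟩ := weights hE hU hS h3
  obtain ⟨D', μ', hμ', hx', hk'⟩ := weights hE hU hS' h3'
  have hw : ∀ i ∈ S, 0 ≤ sg (σ i) * (a i ⬝ᵥ (v' - v)) := by
    intro i hi
    rw [dotProduct_sub, hv i hi]
    by_cases h : i ∈ S'
    · simp [hv' i h]
    · exact (hp' i h).le
  have hw' : ∀ i ∈ S', 0 ≤ sg (σ i) * (a i ⬝ᵥ (v - v')) := by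
    intro i hi
    rw [dotProduct_sub, hv' i hi]
    by_cases h : i ∈ S
    · simp [hv i h]
    · exact (hp i h).le
  have h1 := hk (v' - v)
  have h2 := hk' (v - v')
  have e1 : sg (σ k) * (a k ⬝ᵥ (v' - v)) = - (sg (σ k) * (a k ⬝ᵥ (v - v'))) := by
    rw [dotProduct_sub, dotProduct_sub]; ring
  have p1 := Finset.sum_nonneg (fun i hi => mul_nonneg (hμ i hi).le (hw i hi))
  have p2 := Finset.sum_nonneg (fun i hi => mul_nonneg (hμ' i hi).le (hw' i hi))
  have z : ∑ i ∈ S, μ i * (sg (σ i) * (a i ⬝ᵥ (v' - v))) = 0 := by linarith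
  rw [Finset.sum_eq_zero_iff_of_nonneg (fun i hi => mul_nonneg (hμ i hi).le (hw i hi))] at z
  have hvv : v' - v = 0 := hU S hS _ fun i hi => by
    have h := z i hi
    have hs : sg (σ i) ≠ 0 := by
      intro h0; have := sg_sq (σ i); simp [h0] at this
    simpa [(hμ i hi).ne', hs] using h
  have hvv : v' = v := sub_eq_zero.mp hvv
  subst hvv
  ext i
  constructor
  · intro hi; by_contra hn
    have := hp' i hn
    simp [hv i hi] at this
  · intro hi; by_contra hn
    have := hp i hn
    simp [hv' i hi] at this

theorem lam_ne {a : Fin m → Fin n → ℝ} (hU : Uq a)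
    {S : Finset (Fin m)} (hS : S.card = n) {k : Fin m} (hk : k ∉ S) {i : Fin m} (hi : i ∈ S)
    {d : Fin n → ℝ} (hd : ∀ j ∈ S, j ≠ i → a j ⬝ᵥ d = 0) (h0 : a k ⬝ᵥ d = 0) : d = 0 := by
  refine hU (insert k (S.erase i)) ?_ d ?_
  · rw [Finset.card_insert_of_notMem (fun h => hk (Finset.mem_of_mem_erase h)),
      Finset.card_erase_add_one hi, hS]
  · intro j hj
    rcases Finset.mem_insert.mp hj with rfl | hj
    · exact h0
    · exact hd j (Finset.mem_of_mem_erase hj) (Finset.ne_of_mem_erase hj)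

theorem rel_ex {a : Fin m → Fin n → ℝ} {b : Fin m → ℝ} (hE : Ex a) (hU : Uq a) (hG : Gn a b)
    {S : Finset (Fin m)} (hS : S.card = n) {k : Fin m} (hk : k ∉ S) :
    ∃ σ, BRel a b k S σ := by
  obtain ⟨v, hv⟩ := hE S hS b
  obtain ⟨D, hD, hx⟩ := dual hE hU hS
  have hoff : ∀ i ∉ S, a i ⬝ᵥ v - b i ≠ 0 := by
    intro i hi h
    refine hG (insert i S) (by rw [Finset.card_insert_of_notMem hi, hS]) v ?_
    intro j hj
    rcases Finset.mem_insert.mp hj with rfl | hj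
    · linarith
    · exact hv j hj
  have hl : ∀ i ∈ S, a k ⬝ᵥ D i ≠ 0 := by
    intro i hi h
    have h0 : D i = 0 := lam_ne hU hS hk hi (fun j hj hji => by simp [hD i hi j hj, hji]) h
    have := hD i hi i hi
    simp [h0] at this
  set ek : Bool := decide (0 < a k ⬝ᵥ v - b k)
  have hek : sg ek ≠ 0 := by
    intro h0; have := sg_sq ek; simp [h0] at this
  refine ⟨fun i => if i ∈ S then decide (0 < -(sg ek * (a k ⬝ᵥ D i)))
    else decide (0 < a i ⬝ᵥ v - b i), v, hv, ?_, ?_⟩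
  · intro i hi
    simp only [hi, if_false]
    exact sg_dec _ (hoff i hi)
  · intro i hi d hd hpos
    simp only [hi, if_true] at hpos
    simp only [hk, if_false]
    have h1 := sg_dec (-(sg ek * (a k ⬝ᵥ D i))) (neg_ne_zero.mpr (mul_ne_zero hek (hl i hi)))
    set t := sg (decide (0 < -(sg ek * (a k ⬝ᵥ D i))))
    have h2 : d = (a i ⬝ᵥ d) • D i := by
      conv_lhs => rw [hx d]
      refine Finset.sum_eq_single_of_mem i hi fun j hj hji => ?_
      rw [hd j hj hji, zero_smul]
    have h3 : a k ⬝ᵥ d = (a i ⬝ᵥ d) * (a k ⬝ᵥ D i) := by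
      conv_lhs => rw [h2]
      rw [dotProduct_smul, smul_eq_mul]
    have h4 := mul_pos hpos h1
    have h5 : t * t = 1 := sg_sq _
    have h6 : t * (a i ⬝ᵥ d) * (t * -(sg ek * (a k ⬝ᵥ D i))) = -(sg ek * (a k ⬝ᵥ d)) := by
      rw [h3]
      linear_combination (-(a i ⬝ᵥ d) * sg ek * (a k ⬝ᵥ D i)) * h5
    change sg ek * (a k ⬝ᵥ d) < 0
    linarith

theorem rel_uniq {a : Fin m → Fin n → ℝ} {b : Fin m → ℝ} (hE : Ex a) (hU : Uq a)
    {S : Finset (Fin m)} (hS : S.card = n) {k : Fin m} (hk : k ∉ S) {σ τ : Fin m → Bool}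
    (h : BRel a b k S σ) (h' : BRel a b k S τ) : σ = τ := by
  obtain ⟨v, hv, hp, h3⟩ := h
  obtain ⟨v', hv', hp', h3'⟩ := h'
  have : v' = v := by
    rw [← sub_eq_zero]
    refine hU S hS _ fun i hi => ?_
    rw [dotProduct_sub, hv i hi, hv' i hi, sub_self]
  subst this
  have hoff : ∀ i ∉ S, σ i = τ i := fun i hi => sg_uniq (hp i hi) (hp' i hi)
  obtain ⟨D, hD, hx⟩ := dual hE hU hS
  funext i
  by_cases hi : i ∈ S
  · have e1 := h3 i hi (sg (σ i) • D i)
      (fun j hj hji => by simp [dotProduct_smul, hD i hi j hj, hji])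
      (by simp [dotProduct_smul, hD i hi i hi, sg_sq])
    have e2 := h3' i hi (sg (τ i) • D i)
      (fun j hj hji => by simp [dotProduct_smul, hD i hi j hj, hji])
      (by simp [dotProduct_smul, hD i hi i hi, sg_sq])
    rw [dotProduct_smul, smul_eq_mul] at e1 e2
    rw [← hoff k hk] at e2
    refine sg_uniq (x := -(sg (σ k) * (a k ⬝ᵥ D i))) ?_ ?_ <;> linarith
  · exact hoff i hi

theorem ev_lin (c v d : Fin n → ℝ) (β s : ℝ) (h : 0 < s * (c ⬝ᵥ v - β)) :
    ∀ᶠ δ : ℝ in nhdsWithin 0 (Set.Ioi 0), 0 < s * (c ⬝ᵥ (v + δ • d) - β) := by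
  have hc : Continuous fun δ : ℝ => s * (c ⬝ᵥ (v + δ • d) - β) := by
    simp only [dotProduct_add, dotProduct_smul, smul_eq_mul]
    fun_prop
  refine Filter.Eventually.filter_mono nhdsWithin_le_nhds ?_
  refine hc.continuousAt.eventually (lt_mem_nhds ?_)
  simpa using h

theorem rel_nonempty {a : Fin m → Fin n → ℝ} {b : Fin m → ℝ} (hE : Ex a)
    {S : Finset (Fin m)} (hS : S.card = n) {k : Fin m} {σ : Fin m → Bool}
    (h : BRel a b k S σ) : (Cell a b σ).Nonempty := by
  obtain ⟨v, hv, hp, _⟩ := h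
  obtain ⟨d, hd⟩ := hE S hS (fun i => sg (σ i))
  have : ∀ᶠ δ : ℝ in nhdsWithin 0 (Set.Ioi 0), ∀ i,
      0 < sg (σ i) * (a i ⬝ᵥ (v + δ • d) - b i) := by
    rw [Filter.eventually_all]
    intro i
    by_cases hi : i ∈ S
    · filter_upwards [self_mem_nhdsWithin] with δ hδ
      have hδ : 0 < δ := hδ
      rw [dotProduct_add, dotProduct_smul, hv i hi, hd i hi, smul_eq_mul]
      have : sg (σ i) * (b i + δ * sg (σ i) - b i) = δ := by
        linear_combination δ * sg_sq (σ i)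
      rw [this]; exact hδ
    · exact ev_lin _ _ _ _ _ (hp i hi)
  obtain ⟨δ, hδ⟩ := this.exists
  exact ⟨_, hδ⟩

theorem rel_surj {a : Fin m → Fin n → ℝ} {b : Fin m → ℝ} (hnm : n < m) (hE : Ex a) (hU : Uq a)
    (hG : Gn a b) {k : Fin m} {σ : Fin m → Bool}
    (hne : (Cell a b σ).Nonempty) (hb : Bornology.IsBounded (Cell a b σ)) :
    ∃ S : Finset (Fin m), S.card = n ∧ k ∉ S ∧ BRel a b k S σ := by
  obtain ⟨y, hy⟩ := hne
  set K : Set (Fin n → ℝ) := {x | ∀ i, 0 ≤ sg (σ i) * (a i ⬝ᵥ x - b i)} with hK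
  have hcl : ∀ c : Fin n → ℝ, Continuous fun x : Fin n → ℝ => c ⬝ᵥ x := by
    intro c
    simp only [dotProduct]; fun_prop
  have hKc : IsClosed K := by
    have : K = ⋂ i, {x | 0 ≤ sg (σ i) * (a i ⬝ᵥ x - b i)} := by ext; simp [hK]
    rw [this]
    refine isClosed_iInter fun i => isClosed_le continuous_const ?_
    have := hcl (a i)
    fun_prop
  have hsub : K ⊆ closure (Cell a b σ) := by
    intro x hx
    have ht : Filter.Tendsto (fun δ : ℝ => x + δ • (y - x)) (nhdsWithin 0 (Set.Ioi 0)) (nhds x) := by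
      have hc : Continuous fun δ : ℝ => x + δ • (y - x) := by fun_prop
      have := hc.tendsto 0
      simp only [zero_smul, add_zero] at this
      exact this.mono_left nhdsWithin_le_nhds
    refine mem_closure_of_tendsto ht ?_
    filter_upwards [Ioo_mem_nhdsGT (zero_lt_one' ℝ)] with δ hδ i
    have e : sg (σ i) * (a i ⬝ᵥ (x + δ • (y - x)) - b i) =
        (1 - δ) * (sg (σ i) * (a i ⬝ᵥ x - b i)) + δ * (sg (σ i) * (a i ⬝ᵥ y - b i)) := by
      rw [dotProduct_add, dotProduct_smul, dotProduct_sub, smul_eq_mul]; ring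
    rw [e]
    exact add_pos_of_nonneg_of_pos (mul_nonneg (by linarith [hδ.2]) (hx i))
      (mul_pos hδ.1 (hy i))
  have hcomp : IsCompact K := Metric.isCompact_of_isClosed_isBounded hKc (hb.closure.subset hsub)
  have hyK : y ∈ K := fun i => (hy i).le
  obtain ⟨v, hvK, hmax⟩ := hcomp.exists_isMaxOn ⟨y, hyK⟩
    (f := fun x => sg (σ k) * (a k ⬝ᵥ x - b k)) (by have := hcl (a k); fun_prop)
  have hmax' : ∀ x ∈ K, sg (σ k) * (a k ⬝ᵥ x - b k) ≤ sg (σ k) * (a k ⬝ᵥ v - b k) :=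
    fun x hx => hmax hx
  have hkv : 0 < sg (σ k) * (a k ⬝ᵥ v - b k) := (hy k).trans_le (hmax' y hyK)
  set S : Finset (Fin m) := Finset.univ.filter fun i => a i ⬝ᵥ v = b i with hSdef
  have hmem : ∀ i, i ∈ S ↔ a i ⬝ᵥ v = b i := by intro i; simp [hSdef]
  have hkS : k ∉ S := by
    intro h
    rw [hmem] at h
    simp [h] at hkv
  have hoff : ∀ i ∉ S, 0 < sg (σ i) * (a i ⬝ᵥ v - b i) := by
    intro i hi
    refine lt_of_le_of_ne (hvK i) (fun h => ?_)
    have hs : sg (σ i) ≠ 0 := by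
      intro h0; have := sg_sq (σ i); simp [h0] at this
    rcases mul_eq_zero.mp h.symm with h | h
    · exact hs h
    · exact hi ((hmem i).mpr (by linarith))
  have step : ∀ d, (∀ i ∈ S, 0 ≤ sg (σ i) * (a i ⬝ᵥ d)) → sg (σ k) * (a k ⬝ᵥ d) ≤ 0 := by
    intro d hd
    have : ∀ᶠ δ : ℝ in nhdsWithin 0 (Set.Ioi 0), ∀ i,
        0 ≤ sg (σ i) * (a i ⬝ᵥ (v + δ • d) - b i) := by
      rw [Filter.eventually_all]
      intro i
      by_cases hi : i ∈ S
      · filter_upwards [self_mem_nhdsWithin] with δ hδ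
        have hδ : 0 < δ := hδ
        rw [dotProduct_add, dotProduct_smul, (hmem i).mp hi, smul_eq_mul]
        have := mul_nonneg hδ.le (hd i hi)
        linarith
      · filter_upwards [ev_lin _ _ d _ _ (hoff i hi)] with δ hδ using hδ.le
    obtain ⟨δ, hδ, hδ0⟩ := (this.and self_mem_nhdsWithin).exists
    have hδ0 : 0 < δ := hδ0
    have h1 := hmax' _ hδ
    rw [dotProduct_add, dotProduct_smul, smul_eq_mul] at h1
    have h2 : δ * (sg (σ k) * (a k ⬝ᵥ d)) ≤ 0 := by linarith
    by_contra hc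
    push Not at hc
    exact absurd (mul_pos hδ0 hc) (not_lt.mpr h2)
  have hle : S.card ≤ n := by
    by_contra h
    push Not at h
    obtain ⟨T, hTS, hT⟩ := Finset.exists_subset_card_eq (Nat.succ_le_of_lt h)
    exact hG T hT v fun i hi => (hmem i).mp (hTS hi)
  have hge : n ≤ S.card := by
    by_contra h
    push Not at h
    obtain ⟨T, hTS, hT⟩ := Finset.exists_superset_card_eq (s := insert k S) (n := n)
      (by rw [Finset.card_insert_of_notMem hkS]; omega) (by simp; omega)
    obtain ⟨d, hd⟩ := hE T hT (fun i => if i = k then sg (σ k) else 0)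
    have h1 := step d (fun i hi => by
      rw [hd i (hTS (Finset.mem_insert_of_mem hi))]
      have : i ≠ k := fun h => hkS (h ▸ hi)
      simp [this])
    rw [hd k (hTS (Finset.mem_insert_self _ _))] at h1
    simp only [if_true, sg_sq] at h1
    linarith
  have hS : S.card = n := le_antisymm hle hge
  refine ⟨S, hS, hkS, v, fun i hi => (hmem i).mp hi, hoff, ?_⟩
  intro i hi d hd hpos
  have h1 := step d (fun j hj => by
    by_cases hji : j = i
    · subst hji; exact hpos.le
    · simp [hd j hj hji])
  refine lt_of_le_of_ne h1 fun h0 => ?_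
  have hs : sg (σ k) ≠ 0 := by
    intro h0; have := sg_sq (σ k); simp [h0] at this
  have hd0 : d = 0 := lam_ne hU hS hkS hi hd ((mul_eq_zero.mp h0).resolve_left hs)
  simp [hd0] at hpos

theorem count {a : Fin m → Fin n → ℝ} {b : Fin m → ℝ} (hnm : n < m) (hE : Ex a) (hU : Uq a)
    (hG : Gn a b) :
    Set.ncard {σ | (Cell a b σ).Nonempty ∧ Bornology.IsBounded (Cell a b σ)}
      = (m - 1).choose n := by
  let k : Fin m := ⟨0, by omega⟩
  have hP : ∀ S, S ∈ (Finset.univ.erase k).powersetCard n ↔ S.card = n ∧ k ∉ S := by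
    intro S
    rw [Finset.mem_powersetCard, Finset.subset_erase]
    simp [and_comm]
  have hex : ∀ S, ∃ σ, S ∈ (Finset.univ.erase k).powersetCard n → BRel a b k S σ := by
    intro S
    by_cases h : S ∈ (Finset.univ.erase k).powersetCard n
    · obtain ⟨σ, hσ⟩ := rel_ex hE hU hG ((hP S).mp h).1 ((hP S).mp h).2
      exact ⟨σ, fun _ => hσ⟩
    · exact ⟨fun _ => true, fun h' => absurd h' h⟩
  choose F hF using hex
  have himg : {σ | (Cell a b σ).Nonempty ∧ Bornology.IsBounded (Cell a b σ)}
      = F '' ((Finset.univ.erase k).powersetCard n : Finset (Finset (Fin m))) := by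
    ext σ
    constructor
    · rintro ⟨h1, h2⟩
      obtain ⟨S, hS, hk, hR⟩ := rel_surj (k := k) hnm hE hU hG h1 h2
      have hm := (hP S).mpr ⟨hS, hk⟩
      exact ⟨S, hm, rel_uniq hE hU hS hk (hF S hm) hR⟩
    · rintro ⟨S, hm, rfl⟩
      have hm : S ∈ (Finset.univ.erase k).powersetCard n := hm
      have hS := ((hP S).mp hm).1
      exact ⟨rel_nonempty hE hS (hF S hm), rel_bdd hE hU hS (hF S hm)⟩
  rw [himg, Set.ncard_image_of_injOn, Set.ncard_coe_finset, Finset.card_powersetCard,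
    Finset.card_erase_of_mem (Finset.mem_univ _), Finset.card_univ, Fintype.card_fin]
  intro S hS T hT h
  have hS : S ∈ (Finset.univ.erase k).powersetCard n := hS
  have hT : T ∈ (Finset.univ.erase k).powersetCard n := hT
  exact rel_inj hE hU ((hP S).mp hS).1 ((hP T).mp hT).1 (hF S hS) (h ▸ hF T hT)

end


/-- **Buck's count of bounded full-dimensional cells.**
For almost every `(A, b)`, exactly `C(m-1, n)` of the `2^m` sign conditions
`ε_i ((Ax)_i - b_i) > 0` define a nonempty bounded (open) polyhedron in `ℝ^n`. -/
theorem count_bounded_cells_ae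
    (m n : ℕ) (hn : 1 ≤ n) (hmn : n < m) :
    ∀ᵐ p : Matrix (Fin m) (Fin n) ℝ × (Fin m → ℝ) ∂(volume : Measure ((Fin m → Fin n → ℝ) × (Fin m → ℝ))),
      Set.ncard {σ : Fin m → Bool |
          {x : Fin n → ℝ | ∀ i : Fin m,
              (if σ i then (1 : ℝ) else -1) * ((Matrix.of p.1).mulVec x i - p.2 i) > 0}.Nonempty
          ∧ Bornology.IsBounded
            {x : Fin n → ℝ | ∀ i : Fin m,
              (if σ i then (1 : ℝ) else -1) * ((Matrix.of p.1).mulVec x i - p.2 i) > 0}}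
        = (m - 1).choose n := by
  filter_upwards [gen m n] with p hp
  exact count hmn hp.1 hp.2.1 hp.2.2
end

section
/- Let m > n ≥ 1, let A be a real m×n matrix of rank n, let μ ∈ ℝ be nonzero, and let s, y ∈ ℝ^m satisfy s_i y_i = μ for all i = 1,…,m. Then the linear map from ℝ^n × ℝ^m × ℝ^m to ℝ^m × ℝ^n × ℝ^m defined by (ẋ, ṡ, ẏ) ↦ (A ẋ − ṡ, Aᵀ ẏ, ṡ∘y + s∘ẏ), where ∘ denotes the componentwise product of vectors in ℝ^m, is bijective. -/
/-- **Invertibility of the derivative of the central-path map.**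
If `A` has rank `n`, `μ ≠ 0` and `s_i y_i = μ` for all `i`, then the linear map
`(ẋ, ṡ, ẏ) ↦ (Aẋ − ṡ, Aᵀẏ, ṡ∘y + s∘ẏ)` is bijective. -/
theorem central_path_derivative_bijective
    (m n : ℕ) (hn : 1 ≤ n) (hmn : n < m)
    (A : Matrix (Fin m) (Fin n) ℝ) (hA : A.rank = n)
    (μ : ℝ) (hμ : μ ≠ 0)
    (s y : Fin m → ℝ) (hsy : ∀ i, s i * y i = μ) :
    Function.Bijective
      (fun p : (Fin n → ℝ) × (Fin m → ℝ) × (Fin m → ℝ) =>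
        ((A.mulVec p.1 - p.2.1,
          A.transpose.mulVec p.2.2,
          fun i => p.2.1 i * y i + s i * p.2.2 i) :
          (Fin m → ℝ) × (Fin n → ℝ) × (Fin m → ℝ))) := by
  have hinjA : Function.Injective A.mulVec := by
    rw [Matrix.mulVec_injective_iff, linearIndependent_iff_card_eq_finrank_span,
      Set.finrank, ← Matrix.rank_eq_finrank_span_cols, hA, Fintype.card_fin]
  let L : ((Fin n → ℝ) × (Fin m → ℝ) × (Fin m → ℝ)) →ₗ[ℝ]
      ((Fin m → ℝ) × (Fin n → ℝ) × (Fin m → ℝ)) :=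
    { toFun := fun p => (A.mulVec p.1 - p.2.1, A.transpose.mulVec p.2.2,
          fun i => p.2.1 i * y i + s i * p.2.2 i)
      map_add' := by
        intro p q
        refine Prod.ext ?_ (Prod.ext ?_ ?_)
        · simp only [Prod.fst_add, Prod.snd_add, Matrix.mulVec_add]
          abel
        · simp only [Prod.fst_add, Prod.snd_add, Matrix.mulVec_add]
        · funext i
          simp only [Prod.fst_add, Prod.snd_add, Pi.add_apply]
          ring
      map_smul' := by
        intro c p
        refine Prod.ext ?_ (Prod.ext ?_ ?_)
        · simp [Matrix.mulVec_smul, smul_sub]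
        · simp [Matrix.mulVec_smul]
        · funext i
          simp
          ring }
  have hL : Function.Injective L := by
    rw [← LinearMap.ker_eq_bot, LinearMap.ker_eq_bot']
    rintro ⟨u, v, w⟩ h
    have h1 : A.mulVec u - v = 0 := congrArg Prod.fst h
    have h2 : A.transpose.mulVec w = 0 := congrArg (fun q => q.2.1) h
    have h3 : ∀ i, v i * y i + s i * w i = 0 := fun i => congrFun (congrArg (fun q => q.2.2) h) i
    have hv : v = A.mulVec u := (sub_eq_zero.mp h1).symm
    have hs : ∀ i, s i ≠ 0 := fun i hi => hμ (by rw [← hsy i, hi, zero_mul])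
    have h4 : w ⬝ᵥ v = 0 := by
      rw [hv, Matrix.dotProduct_mulVec, ← Matrix.mulVec_transpose, h2, zero_dotProduct]
    have h5 : ∑ i, (s i * w i) ^ 2 = 0 := by
      have : ∑ i, (s i * w i) ^ 2 = -μ * ∑ i, w i * v i := by
        rw [Finset.mul_sum]
        refine Finset.sum_congr rfl fun i _ => ?_
        linear_combination (s i * w i) * h3 i - (w i * v i) * hsy i
      rw [this]
      have h4' : ∑ i, w i * v i = 0 := h4
      rw [h4', mul_zero]
    have hw : ∀ i, w i = 0 := by
      intro i
      have := (Finset.sum_eq_zero_iff_of_nonneg (fun i _ => sq_nonneg (s i * w i))).mp h5 i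
        (Finset.mem_univ i)
      exact (mul_eq_zero.mp (pow_eq_zero_iff two_ne_zero |>.mp this)).resolve_left (hs i)
    have hv0 : v = 0 := by
      funext i
      have h := h3 i
      rw [hw i, mul_zero, add_zero] at h
      exact (mul_eq_zero.mp h).resolve_right
        (fun hi => hμ (by rw [← hsy i, hi, mul_zero]))
    have hu : u = 0 := hinjA (by rw [← hv, hv0, Matrix.mulVec_zero])
    have hw0 : w = 0 := funext hw
    rw [hu, hv0, hw0]
    rfl
  have hdim : Module.finrank ℝ ((Fin n → ℝ) × (Fin m → ℝ) × (Fin m → ℝ)) =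
      Module.finrank ℝ ((Fin m → ℝ) × (Fin n → ℝ) × (Fin m → ℝ)) := by
    simp only [Module.finrank_prod]
    omega
  exact ⟨hL, (LinearMap.injective_iff_surjective_of_finrank_eq_finrank hdim).mp hL⟩
end

section
/- Let m > n ≥ 1, let A be a real m×n matrix of rank n, b ∈ ℝ^m, c ∈ ℝ^n, and μ > 0. Suppose (x, s, y) ∈ ℝ^n × ℝ^m × ℝ^m satisfies Ax − s = b, Aᵀy = c, and s_i y_i = μ for all i, and suppose (ẋ, ṡ, ẏ) ∈ ℝ^n × ℝ^m × ℝ^m satisfies A ẋ = ṡ, Aᵀ ẏ = 0, and ṡ∘y + s∘ẏ = e, where ∘ denotes the componentwise product and e = (1,…,1) ∈ ℝ^m. Then: (1) (ṡ, ẏ) ≠ (0,0); (2) if c ≠ 0 then ṡ ≠ 0 (hence (ẋ, ṡ) ≠ 0); (3) if b does not lie in the column space of A, then ẏ ≠ 0. -/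
/-- **The Gauss curves of the central paths are well defined.**
For a point on the primal/dual central path together with its velocity vector:
(1) `(ṡ, ẏ) ≠ (0, 0)`; (2) if `c ≠ 0` then `ṡ ≠ 0`; (3) if `b` is not in the
column space of `A` then `ẏ ≠ 0`. -/
theorem central_path_speed_nonzero
    (m n : ℕ) (hn : 1 ≤ n) (hmn : n < m)
    (A : Matrix (Fin m) (Fin n) ℝ) (hA : A.rank = n)
    (b : Fin m → ℝ) (c : Fin n → ℝ) (μ : ℝ) (hμ : 0 < μ)
    (x xd : Fin n → ℝ) (s y sd yd : Fin m → ℝ)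
    (h1 : A.mulVec x - s = b)
    (h2 : A.transpose.mulVec y = c)
    (h3 : ∀ i, s i * y i = μ)
    (h4 : A.mulVec xd = sd)
    (h5 : A.transpose.mulVec yd = 0)
    (h6 : ∀ i, sd i * y i + s i * yd i = 1) :
    (¬(sd = 0 ∧ yd = 0))
    ∧ (c ≠ 0 → sd ≠ 0)
    ∧ (b ∉ Set.range A.mulVec → yd ≠ 0) := by
  refine ⟨?_, ?_, ?_⟩
  · rintro ⟨hs, hy⟩
    have := h6 ⟨0, by omega⟩
    simp [hs, hy] at this
  · intro hc hs
    apply hc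
    have hy : y = μ • yd := by
      ext i
      have h := h6 i
      simp only [hs, Pi.zero_apply, zero_mul, zero_add] at h
      simp only [Pi.smul_apply, smul_eq_mul]
      linear_combination (-y i) * h + yd i * h3 i
    rw [← h2, hy, Matrix.mulVec_smul, h5, smul_zero]
  · intro hb hy
    apply hb
    have hs : s = μ • sd := by
      ext i
      have h := h6 i
      simp only [hy, Pi.zero_apply, mul_zero, add_zero] at h
      simp only [Pi.smul_apply, smul_eq_mul]
      linear_combination (-s i) * h + sd i * h3 i
    refine ⟨x - μ • xd, ?_⟩
    rw [Matrix.mulVec_sub, Matrix.mulVec_smul, h4, ← hs, h1]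
end
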